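/- Let V, Q be nonzero vector spaces of dimensions r and n−r, and 𝓘=(I^1,…,I^s) an s-tuple of subsets of [n] each of cardinality r. For a generic point (𝓕,𝓖) ∈ Fl(V)^s × Fl(Q)^s, there exist a filtration by subspaces S^{(h)} ⊊ S^{(h−1)} ⊊ … ⊊ S^{(1)} ⊊ S^{(0)} = V and injective linear maps η_u: S^{(u)}/S^{(u+1)} ↪ Q for u=0,…,h−1 with the following properties, where for u=1,…,h, d_u = dim S^{(u)} and 𝓙(u)=(J^1(u),…,J^s(u)) is the unique s-tuple of subsets of [r], each of cardinality d_u, with S^{(u)} ∈ ∩_{j=1}^{s} Ω°_{J^j(u)}(F^j_•): (i) dim(S^{(h)}, V, 𝓕) = 0; (ii) for u=0,…,h−1, j=1,…,s and a=1,…,r, η_u(S^{(u)} ∩ F^j_a) ⊆ G^j_{i^j_a−a} (writing η_u also for the composite S^{(u)} → S^{(u)}/S^{(u+1)} → Q); (iii) dim Hom_𝓘(V,Q,𝓕,𝓖) = [dim(Gr(r,n)) − Σ_{j=1}^{s} codim(ω_{I^j})] + [Σ_{j=1}^{s} Σ_{a∈J^j(h)}(n−r+a−i^j_a) − d_h(n−r)].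 -/

import Mathlib

noncomputable section

open Module Submodule

/-! ### Polynomial functions and the Zariski topology on a vector space -/

/-- Evaluation of a polynomial in linear functionals at a point of a vector space.
These are exactly the polynomial functions on a finite-dimensional vector space. -/
def mEval (k : Type*) {M : Type*} [Field k] [AddCommGroup M] [Module k M]
    (x : M) (p : MvPolynomial (Module.Dual k M) k) : k :=
  MvPolynomial.eval (fun l : Module.Dual k M => l x) p

/-- The Zariski topology on a (finite-dimensional) vector space, generated by the
complements of zero sets of polynomial functions. -/
def mZariski (k M : Type*) [Field k] [AddCommGroup M] [Module k M] :
    TopologicalSpace M :=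
  TopologicalSpace.generateFrom
    {U : Set M | ∃ p : MvPolynomial (Module.Dual k M) k, U = {x : M | mEval k x p ≠ 0}}

/-- The Zariski tangent space at a point `x` to a subset `A` of a vector space:
the common kernel of the differentials at `x` of all polynomial functions vanishing on `A`. -/
def mTangent (k : Type*) {M : Type*} [Field k] [AddCommGroup M] [Module k M]
    (A : Set M) (x : M) : Submodule k M :=
  letI := Classical.decEq (Module.Dual k M)
  ⨅ p ∈ {p : MvPolynomial (Module.Dual k M) k | ∀ a ∈ A, mEval k a p = 0},
    LinearMap.ker (∑ l ∈ p.vars, mEval k x (MvPolynomial.pderiv l p) • (l : Module.Dual k M))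

/-- `f : M → N` is a polynomial map on a subset `A ⊆ M`. -/
def IsPolyOn (k : Type*) {M N : Type*} [Field k] [AddCommGroup M] [Module k M]
    [AddCommGroup N] [Module k N] (A : Set M) (f : M → N) : Prop :=
  ∀ l : Module.Dual k N, ∃ p : MvPolynomial (Module.Dual k M) k, ∀ x ∈ A, l (f x) = mEval k x p

/-- Dimension (topological Krull dimension) of a subset of a topological space. -/
def subDim {α : Type*} (t : TopologicalSpace α) (C : Set α) : WithBot ℕ∞ :=
  @topologicalKrullDim C (TopologicalSpace.induced (Subtype.val : C → α) t)

/-- The irreducible components of a subset `A` of a topological space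
(for the subspace topology). -/
def subComponents {α : Type*} (t : TopologicalSpace α) (A : Set α) : Set (Set ↥A) :=
  @irreducibleComponents A (TopologicalSpace.induced (Subtype.val : A → α) t)

/-- Dimension of a subset `C` of a subspace `A` of a topological space. -/
def compDim {α : Type*} (t : TopologicalSpace α) (A : Set α) (C : Set ↥A) : WithBot ℕ∞ :=
  subDim (TopologicalSpace.induced (Subtype.val : A → α) t) C

/-! ### Flags, Schubert cells and Schubert varieties -/

/-- A complete flag on a finite-dimensional vector space, recorded as the increasing
function sending `m` to the `m`-th member (of dimension `m`) of the flag. -/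
def IsFlag {k M : Type*} [Field k] [AddCommGroup M] [Module k M]
    (E : ℕ → Submodule k M) : Prop :=
  Monotone E ∧ ∀ m : ℕ, finrank k ↥(E m) = min m (finrank k M)

/-- Membership of `V` in the (open) Schubert cell `Ω°_I(E_•) ⊆ Gr(r, M)` attached to the
subset `I ⊆ [n]` recorded by the strictly increasing tuple `i : Fin r → Fin n`
(`0`-indexed: the `1`-based subset is `{i a + 1}`): `dim (V ∩ E_u) = #{a | i_a ≤ u}`. -/
def cellMem {k M : Type*} [Field k] [AddCommGroup M] [Module k M] {n r : ℕ}
    (i : Fin r → Fin n) (E : ℕ → Submodule k M) (V : Submodule k M) : Prop :=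
  finrank k ↥V = r ∧
    ∀ u : ℕ, u ≤ n →
      finrank k ↥(V ⊓ E u) =
        (Finset.univ.filter (fun a : Fin r => (i a : ℕ) + 1 ≤ u)).card

/-- Membership of `V` in the (closed) Schubert variety `Ω_I(E_•) ⊆ Gr(r, M)`:
`dim (V ∩ E_{i_a}) ≥ a` for `a = 1, …, r`. -/
def varMem {k M : Type*} [Field k] [AddCommGroup M] [Module k M] {n r : ℕ}
    (i : Fin r → Fin n) (E : ℕ → Submodule k M) (V : Submodule k M) : Prop :=
  finrank k ↥V = r ∧ ∀ a : Fin r, (a : ℕ) + 1 ≤ finrank k ↥(V ⊓ E ((i a : ℕ) + 1))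

/-- The flag induced on a subspace `V` by a flag `E` on `M`: its `a`-th member is the
smallest subspace of the form `V ∩ E_u` of dimension `≥ a`. -/
def indSub {k M : Type*} [Field k] [AddCommGroup M] [Module k M]
    (E : ℕ → Submodule k M) (V : Submodule k M) : ℕ → Submodule k ↥V := fun a =>
  ⨅ u ∈ {u : ℕ | a ≤ finrank k ↥(Submodule.comap V.subtype (E u))},
    Submodule.comap V.subtype (E u)

/-- The flag induced on the quotient `M ⧸ V` by a flag `E` on `M`: its `b`-th member is
the smallest subspace of the form `(E_u + V)/V` of dimension `≥ b`. -/
def indQuot {k M : Type*} [Field k] [AddCommGroup M] [Module k M]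
    (E : ℕ → Submodule k M) (V : Submodule k M) : ℕ → Submodule k (M ⧸ V) := fun b =>
  ⨅ u ∈ {u : ℕ | b ≤ finrank k ↥(Submodule.map V.mkQ (E u))},
    Submodule.map V.mkQ (E u)

/-- The flag spanned by a tuple of vectors (a complete flag when the tuple is a basis). -/
def spanFlag (k : Type*) {M : Type*} [Field k] [AddCommGroup M] [Module k M] {r : ℕ}
    (b : Fin r → M) : ℕ → Submodule k M := fun m =>
  Submodule.span k (b '' {a : Fin r | (a : ℕ) < m})

/-- `P` holds for a generic point of `Fl(M)^s` (`r = dim M`): there is a nonempty Zariski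
open set of `s`-tuples of bases of `M` on which the associated tuples of complete flags
satisfy `P`. -/
def GenericFlags (k : Type*) {M : Type*} [Field k] [AddCommGroup M] [Module k M]
    (s r : ℕ) (P : (Fin s → ℕ → Submodule k M) → Prop) : Prop :=
  ∃ U : Set (Fin s → Fin r → M),
    @IsOpen _ (mZariski k (Fin s → Fin r → M)) U ∧
    (∃ b ∈ U, ∀ j, LinearIndependent k (b j)) ∧
    ∀ b ∈ U, (∀ j, LinearIndependent k (b j)) → P (fun j => spanFlag k (b j))

/-- `P` holds for a generic point of `Fl(M)^s × Fl(Q)^s` (`r = dim M`, `q = dim Q`). -/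
def GenericFlagPairs (k : Type*) {M Q : Type*} [Field k] [AddCommGroup M] [Module k M]
    [AddCommGroup Q] [Module k Q] (s r q : ℕ)
    (P : (Fin s → ℕ → Submodule k M) → (Fin s → ℕ → Submodule k Q) → Prop) : Prop :=
  ∃ U : Set ((Fin s → Fin r → M) × (Fin s → Fin q → Q)),
    @IsOpen _ (mZariski k ((Fin s → Fin r → M) × (Fin s → Fin q → Q))) U ∧
    (∃ b ∈ U, (∀ j, LinearIndependent k (b.1 j)) ∧ ∀ j, LinearIndependent k (b.2 j)) ∧
    ∀ b ∈ U, ((∀ j, LinearIndependent k (b.1 j)) ∧ ∀ j, LinearIndependent k (b.2 j)) →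
      P (fun j => spanFlag k (b.1 j)) (fun j => spanFlag k (b.2 j))

/-! ### The spaces `Hom_𝓘(V, Q, 𝓕, 𝓖)` -/

/-- The subspace `{φ : M →ₗ Q | φ(p) ⊆ q}` of `Hom(M, Q)`. -/
def homConstraint {k M Q : Type*} [Field k] [AddCommGroup M] [Module k M]
    [AddCommGroup Q] [Module k Q] (p : Submodule k M) (q : Submodule k Q) :
    Submodule k (M →ₗ[k] Q) :=
  LinearMap.ker ((LinearMap.llcomp k ↥p Q (Q ⧸ q) q.mkQ).comp (LinearMap.lcomp k Q p.subtype))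

/-- `Hom_𝓘(M, Q, F, G) = {φ | φ(F^j_a) ⊆ G^j_{i^j_a - a} for all a = 1, …, r, j = 1, …, s}`. -/
def homSpace {k M Q : Type*} [Field k] [AddCommGroup M] [Module k M]
    [AddCommGroup Q] [Module k Q] {n r s : ℕ} (I : Fin s → Fin r → Fin n)
    (F : Fin s → ℕ → Submodule k M) (G : Fin s → ℕ → Submodule k Q) :
    Submodule k (M →ₗ[k] Q) :=
  ⨅ j : Fin s, ⨅ a : Fin r,
    homConstraint (F j ((a : ℕ) + 1)) (G j ((I j a : ℕ) - (a : ℕ)))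

/-! ### Charts on the Grassmannian, tangent spaces to Schubert cells -/

/-- The graph of `ψ : V →ₗ C`, a point of the Grassmannian chart around `V`
determined by a complement `C` of `V`. -/
def graphMap {k M : Type*} [Field k] [AddCommGroup M] [Module k M]
    (V C : Submodule k M) (ψ : ↥V →ₗ[k] ↥C) : Submodule k M :=
  LinearMap.range (V.subtype + C.subtype ∘ₗ ψ)

/-- The canonical identification `Hom(V, C) ≃ Hom(V, M/V)` (derivative of the chart). -/
def conjMap {k M : Type*} [Field k] [AddCommGroup M] [Module k M]
    (V C : Submodule k M) : (↥V →ₗ[k] ↥C) →ₗ[k] (↥V →ₗ[k] M ⧸ V) :=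
  LinearMap.llcomp k ↥V ↥C (M ⧸ V) (V.mkQ ∘ₗ C.subtype)

/-- The tangent space at `V` to a set `S` of points of the Grassmannian `Gr(r, M)`,
computed in the chart determined by a complement `C` of `V` and viewed inside
`Hom(V, M/V)` via the canonical identification. -/
def grTangent {k M : Type*} [Field k] [AddCommGroup M] [Module k M]
    (S : Set (Submodule k M)) (V C : Submodule k M) :
    Submodule k (↥V →ₗ[k] (M ⧸ V)) :=
  Submodule.map (conjMap V C)
    (mTangent k {ψ : ↥V →ₗ[k] ↥C | graphMap V C ψ ∈ S} 0)

/-- The Zariski topology on the Grassmannian of `r`-dimensional subspaces of `M`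
(as a topology on `Submodule k M`), coinduced from the Stiefel parameterization by
spanning `r`-tuples. -/
def grTop (k : Type*) {M : Type*} [Field k] [AddCommGroup M] [Module k M] (r : ℕ) :
    TopologicalSpace (Submodule k M) :=
  TopologicalSpace.coinduced (fun b : Fin r → M => Submodule.span k (Set.range b))
    (mZariski k (Fin r → M))

/-! ### Numerical quantities -/

/-- `codim ω_I = ∑_{a=1}^r (n - r + a - i_a)` (as an integer). -/
def codimZ (n r : ℕ) (i : Fin r → Fin n) : ℤ :=
  ∑ a : Fin r, ((n : ℤ) - (r : ℤ) + ((a : ℕ) : ℤ) - ((i a : ℕ) : ℤ))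

/-- The quantity `∑_j ∑_{a ∈ K^j} (n - r + a - i^j_a) - d(n - r)` of Inequality `(†^𝓘_𝓚)`. -/
def daggerZ (n r d : ℕ) {s : ℕ} (I : Fin s → Fin r → Fin n)
    (K : Fin s → Fin d → Fin r) : ℤ :=
  (∑ j : Fin s, ∑ t : Fin d,
      ((n : ℤ) - (r : ℤ) + ((K j t : ℕ) : ℤ) - ((I j (K j t) : ℕ) : ℤ)))
    - (d : ℤ) * ((n : ℤ) - (r : ℤ))

/-- The expected dimension `dim(S, M, 𝓕) = d(m - d) - ∑_j ∑_{t=1}^d (m - d + t - k^j_t)`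
of an intersection of Schubert cells `Ω°_{K^j}` in `Gr(d, m)`. -/
def eDimZ {s : ℕ} (m d : ℕ) (K : Fin s → Fin d → Fin m) : ℤ :=
  (d : ℤ) * ((m : ℤ) - (d : ℤ)) -
    ∑ j : Fin s, ∑ t : Fin d,
      ((m : ℤ) - (d : ℤ) + ((t : ℕ) : ℤ) - ((K j t : ℕ) : ℤ))

/-- `codim ω_I` as a natural number. -/
def codimN (n r : ℕ) (i : Fin r → Fin n) : ℕ :=
  ∑ a : Fin r, ((n - r + (a : ℕ)) - (i a : ℕ))

/-! ### The cohomology ring of the Grassmannian, Schubert classes -/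

/-- The ideal `(h_{n-r+1}, …, h_n)` of the polynomial ring in `r` variables
(`h_m` the complete homogeneous symmetric polynomials). -/
def grassIdeal (r n : ℕ) : Ideal (MvPolynomial (Fin r) ℤ) :=
  Ideal.span ((fun m : ℕ => MvPolynomial.hsymm (Fin r) ℤ m) '' Set.Icc (n - r + 1) n)

/-- A presentation of the cohomology (Chow) ring `H^*(Gr(r,n))`: products of Schubert
classes vanish here exactly when they vanish in `H^*(Gr(r,n))`. -/
abbrev grassRing (r n : ℕ) : Type :=
  MvPolynomial (Fin r) ℤ ⧸ grassIdeal r n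

/-- `h_m` for an integer `m` (zero for negative `m`). -/
def hkZ (r : ℕ) (m : ℤ) : MvPolynomial (Fin r) ℤ :=
  if 0 ≤ m then MvPolynomial.hsymm (Fin r) ℤ m.toNat else 0

/-- The Schur polynomial (Jacobi–Trudi determinant) of the partition
`λ_a = n - r + a - i_a` attached to the subset `I ⊆ [n]` recorded by `i`. -/
def schurI {n r : ℕ} (i : Fin r → Fin n) : MvPolynomial (Fin r) ℤ :=
  Matrix.det (Matrix.of fun a b : Fin r =>
    hkZ r ((n : ℤ) - (r : ℤ) + ((b : ℕ) : ℤ) - ((i a : ℕ) : ℤ)))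

/-- The Schubert class `ω_I ∈ H^*(Gr(r,n))` of the subset `I ⊆ [n]` recorded by the
strictly increasing tuple `i : Fin r → Fin n`. -/
def omegaCls {n r : ℕ} (i : Fin r → Fin n) : grassRing r n :=
  Ideal.Quotient.mk (grassIdeal r n) (schurI i)

/-- The class of a point in `H^*(Gr(r,n))`: the Schubert class of `I = {1, …, r}`. -/
def pointCls (r n : ℕ) (h : r ≤ n) : grassRing r n :=
  omegaCls (fun a : Fin r => Fin.castLE h a)

/-! ### Schur polynomials of partitions, Littlewood–Richardson coefficients -/

/-- The Schur polynomial of a partition with at most `r` parts, via Jacobi–Trudi. -/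
def schurP {r : ℕ} (lam : Fin r → ℕ) : MvPolynomial (Fin r) ℤ :=
  Matrix.det (Matrix.of fun a b : Fin r =>
    hkZ r (((lam a : ℕ) : ℤ) - ((a : ℕ) : ℤ) + ((b : ℕ) : ℤ)))

/-- The Vandermonde alternant `a_δ = det(x_a^{r-1-b})`. -/
def alternant (r : ℕ) : MvPolynomial (Fin r) ℤ :=
  Matrix.det (Matrix.of fun a b : Fin r => (MvPolynomial.X a) ^ (r - 1 - (b : ℕ)))

/-- The coefficient of the Schur polynomial `s_δ` in a symmetric polynomial `f`
(in `r` variables): the coefficient of the monomial `x^{δ + (r-1, …, 1, 0)}` in `f ⬝ a_δ`. -/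
def schurCoeff (r : ℕ) (f : MvPolynomial (Fin r) ℤ) (δ : Fin r → ℕ) : ℤ :=
  MvPolynomial.coeff
    (Finsupp.equivFunOnFinite.symm (fun a : Fin r => δ a + (r - 1 - (a : ℕ))))
    (f * alternant r)

/-- The Littlewood–Richardson coefficient `c^λ_{μ,ν}` (partitions with at most `r` parts):
the multiplicity of `V_λ` in `V_μ ⊗ V_ν`, i.e. of `s_λ` in `s_μ s_ν`. -/
def lrCoeff (r : ℕ) (lam mu nu : Fin r → ℕ) : ℤ :=
  schurCoeff r (schurP mu * schurP nu) lam

/-- The multiplicity of `V_δ` in `V_{Λ 1} ⊗ ⋯ ⊗ V_{Λ t}` (as `GL(r)`-representations),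
i.e. of `s_δ` in `∏_j s_{Λ j}`. -/
def multiCoeff (r : ℕ) {t : ℕ} (Λ : Fin t → Fin r → ℕ) (δ : Fin r → ℕ) : ℤ :=
  schurCoeff r (∏ j : Fin t, schurP (Λ j)) δ


section Transcendence

variable {k Ω : Type} [Field k] [Field Ω] [Algebra k Ω]

open Algebra in
/-- If every member of an algebraically independent family is rational over the members of a
finite family `w`, then it has at most as many members as `w`; in case of equality, `w` is itself
algebraically independent. -/
theorem algebraicIndependent_of_mem_adjoin {X Y : Type} [Fintype X] [Fintype Y]
    {z : X → Ω} (hz : AlgebraicIndependent k z) {w : Y → Ω}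
    (h : ∀ x, z x ∈ IntermediateField.adjoin k (Set.range w)) :
    Fintype.card X ≤ Fintype.card Y ∧
      (Fintype.card Y ≤ Fintype.card X → AlgebraicIndependent k w) := by
  set L := IntermediateField.adjoin k (Set.range w) with hL
  let w' : Y → L := fun y => ⟨w y, IntermediateField.subset_adjoin k _ ⟨y, rfl⟩⟩
  let z' : X → L := fun x => ⟨z x, h x⟩
  have hz' : AlgebraicIndependent k z' := by
    apply AlgebraicIndependent.of_comp L.val
    exact hz
  have htop : IntermediateField.adjoin k (Set.range w') = ⊤ := by
    apply IntermediateField.map_injective L.val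
    rw [IntermediateField.adjoin_map, ← Set.range_comp]
    have : (⇑L.val ∘ w') = w := rfl
    rw [this, ← hL, ← AlgHom.fieldRange_eq_map, IntermediateField.fieldRange_val]
  have : Algebra.IsAlgebraic (Algebra.adjoin k (Set.range w')) L := by
    constructor
    intro a
    have ha : a ∈ IntermediateField.adjoin k (Set.range w') := htop ▸ IntermediateField.mem_top
    obtain ⟨r, hr, s, hs, rfl⟩ := (IntermediateField.mem_adjoin_iff_div).1 ha
    have h1 := isAlgebraic_algebraMap (A := L) (⟨r, hr⟩ : Algebra.adjoin k (Set.range w'))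
    have h2 := isAlgebraic_algebraMap (A := L) (⟨s, hs⟩ : Algebra.adjoin k (Set.range w'))
    rw [div_eq_mul_inv]
    exact h1.mul h2.inv
  have hle : trdeg k L ≤ Cardinal.mk Y :=
    (IsAlgebraic.trdeg_le_cardinalMk k (Set.range w')).trans Cardinal.mk_range_le
  have hge := hz'.cardinalMk_le_trdeg
  refine ⟨by simpa using hge.trans hle, fun hc => ?_⟩
  have : Cardinal.mk Y ≤ trdeg k L := le_trans (by simpa using hc) hge
  have hb := IsAlgebraic.isTranscendenceBasis_of_le_trdeg_of_finite k w' this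
  exact hb.1.map' (f := L.val) L.val.injective

open Algebra in
/-- Over a base with infinite transcendence degree, a finite algebraically independent family can
be enlarged by any finite number of further members. -/
theorem exists_algebraicIndependent_sumElim
    (hΩ : Cardinal.aleph0 ≤ trdeg k Ω) {X : Type} [Finite X]
    {z : X → Ω} (hz : AlgebraicIndependent k z) (Y : Type) [Finite Y] :
    ∃ c : Y → Ω, AlgebraicIndependent k (Sum.elim z c) := by
  obtain ⟨t, hst, ht⟩ := exists_isTranscendenceBasis_superset (R := k) hz.coe_range
  have htinf : t.Infinite := by
    rw [← Set.infinite_coe_iff, Cardinal.infinite_iff, ht.cardinalMk_eq_trdeg]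
    exact hΩ
  have hinf : (t \ Set.range z).Infinite := htinf.sdiff (Set.finite_range z)
  have := hinf.to_subtype
  obtain ⟨g⟩ : Nonempty (Y ↪ ↥(t \ Set.range z)) := by
    obtain ⟨n, ⟨e⟩⟩ := Finite.exists_equiv_fin Y
    exact ⟨e.toEmbedding.trans (Fin.valEmbedding.trans (Infinite.natEmbedding _))⟩
  refine ⟨fun y => g y, ?_⟩
  let φ : X ⊕ Y → t := Sum.elim (fun x => ⟨z x, hst ⟨x, rfl⟩⟩) (fun y => ⟨g y, (g y).2.1⟩)
  have hφ : Function.Injective φ := by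
    rintro (a | a) (b | b) hab
    · rw [hz.injective (congrArg Subtype.val hab)]
    · exact ((g b).2.2 ⟨a, congrArg Subtype.val hab⟩).elim
    · exact ((g a).2.2 ⟨b, (congrArg Subtype.val hab).symm⟩).elim
    · have hval : (φ (Sum.inr a)).1 = (φ (Sum.inr b)).1 := congrArg _ hab
      have : g a = g b := Subtype.ext hval
      rw [g.injective this]
  have := ht.1.comp φ hφ
  convert this using 1
  ext (a | a) <;> rfl

end Transcendence

section Representations

/-- The linear maps along the arrows of a representation of the quiver with source and target
maps `src` and `tgt`, on the vector spaces `V v`. -/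
def RepMaps (K : Type) [Field K] {ι κ : Type} (src tgt : κ → ι) (V : ι → Type)
    [∀ v, AddCommGroup (V v)] [∀ v, Module K (V v)] : Type :=
  ∀ a : κ, V (src a) →ₗ[K] V (tgt a)

/-- The dimension vector of a family of vector spaces. -/
def dimVec (K : Type) [Field K] {ι : Type} (V : ι → Type)
    [∀ v, AddCommGroup (V v)] [∀ v, Module K (V v)] : ι → ℤ :=
  fun v => (finrank K (V v) : ℤ)

/-- The Euler form of a quiver. -/
def eulerForm {ι κ : Type} [Fintype ι] [Fintype κ] (src tgt : κ → ι) (α β : ι → ℤ) : ℤ :=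
  ∑ v, α v * β v - ∑ a, α (src a) * β (tgt a)

section Euler

variable {ι κ : Type} [Fintype ι] [Fintype κ] (src tgt : κ → ι)

theorem eulerForm_add_left (α α' β : ι → ℤ) :
    eulerForm src tgt (α + α') β = eulerForm src tgt α β + eulerForm src tgt α' β := by
  simp only [eulerForm, Pi.add_apply, add_mul, Finset.sum_add_distrib]; ring

theorem eulerForm_sub_left (α α' β : ι → ℤ) :
    eulerForm src tgt (α - α') β = eulerForm src tgt α β - eulerForm src tgt α' β := by
  simp only [eulerForm, Pi.sub_apply, sub_mul, Finset.sum_sub_distrib]; ring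

theorem eulerForm_sub_right (α β β' : ι → ℤ) :
    eulerForm src tgt α (β - β') = eulerForm src tgt α β - eulerForm src tgt α β' := by
  simp only [eulerForm, Pi.sub_apply, mul_sub, Finset.sum_sub_distrib]; ring

end Euler

variable {K : Type} [Field K] {ι κ : Type} {src tgt : κ → ι}
  {V W : ι → Type} [∀ v, AddCommGroup (V v)] [∀ v, Module K (V v)]
  [∀ v, AddCommGroup (W v)] [∀ v, Module K (W v)]
  {A X : ι → Type} [∀ v, AddCommGroup (A v)] [∀ v, Module K (A v)]
  [∀ v, AddCommGroup (X v)] [∀ v, Module K (X v)]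

/-- The standard differential whose kernel is the space of morphisms of representations. -/
def repDiff (x : RepMaps K src tgt V) (y : RepMaps K src tgt W) :
    (∀ v, V v →ₗ[K] W v) →ₗ[K] (∀ a, V (src a) →ₗ[K] W (tgt a)) where
  toFun φ := fun a => φ (tgt a) ∘ₗ x a - y a ∘ₗ φ (src a)
  map_add' φ ψ := by
    ext a m
    simp only [Pi.add_apply, LinearMap.sub_apply, LinearMap.comp_apply, LinearMap.add_apply,
      map_add]
    abel
  map_smul' c φ := by
    ext a m
    simp [smul_sub]

/-- The space of morphisms between two representations. -/
def repHom (x : RepMaps K src tgt V) (y : RepMaps K src tgt W) :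
    Submodule K (∀ v, V v →ₗ[K] W v) :=
  LinearMap.ker (repDiff x y)

theorem mem_repHom {x : RepMaps K src tgt V} {y : RepMaps K src tgt W}
    {φ : ∀ v, V v →ₗ[K] W v} :
    φ ∈ repHom x y ↔ ∀ a m, φ (tgt a) (x a m) = y a (φ (src a) m) := by
  rw [repHom, LinearMap.mem_ker, funext_iff]
  refine forall_congr' fun a => ?_
  rw [LinearMap.ext_iff]
  refine forall_congr' fun m => ?_
  change φ (tgt a) (x a m) - y a (φ (src a) m) = 0 ↔ _
  rw [sub_eq_zero]

variable [Fintype ι] [Fintype κ]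

/-- The dimension of the cokernel of `repDiff`, that is of the first extension group. -/
def extDim (x : RepMaps K src tgt V) (y : RepMaps K src tgt W) : ℤ :=
  (finrank K (repHom x y) : ℤ) - eulerForm src tgt (dimVec K V) (dimVec K W)

variable [∀ v, FiniteDimensional K (V v)] [∀ v, FiniteDimensional K (W v)]
  [∀ v, FiniteDimensional K (A v)] [∀ v, FiniteDimensional K (X v)]

theorem eulerForm_dimVec (src tgt : κ → ι) (V W : ι → Type) [∀ v, AddCommGroup (V v)]
    [∀ v, Module K (V v)] [∀ v, AddCommGroup (W v)] [∀ v, Module K (W v)]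
    [∀ v, FiniteDimensional K (V v)] [∀ v, FiniteDimensional K (W v)] :
    eulerForm src tgt (dimVec K V) (dimVec K W) =
      (finrank K (∀ v, V v →ₗ[K] W v) : ℤ) -
        (finrank K (∀ a, V (src a) →ₗ[K] W (tgt a)) : ℤ) := by
  rw [Module.finrank_pi_fintype, Module.finrank_pi_fintype]
  simp [eulerForm, dimVec, Module.finrank_linearMap]

theorem extDim_eq (x : RepMaps K src tgt V) (y : RepMaps K src tgt W) :
    extDim x y = (finrank K (∀ a, V (src a) →ₗ[K] W (tgt a)) : ℤ) -
      (finrank K (LinearMap.range (repDiff x y)) : ℤ) := by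
  have := LinearMap.finrank_range_add_finrank_ker (repDiff x y)
  rw [extDim, eulerForm_dimVec, repHom]
  omega

theorem extDim_nonneg (x : RepMaps K src tgt V) (y : RepMaps K src tgt W) :
    0 ≤ extDim x y := by
  have := Submodule.finrank_le (LinearMap.range (repDiff x y))
  rw [extDim_eq]
  omega

/-- The extension group of `(V, W)` surjects onto that of a subrepresentation of `V` and a
quotient of `W`. -/
theorem neg_eulerForm_le_extDim (x : RepMaps K src tgt V) (y : RepMaps K src tgt W)
    (xA : RepMaps K src tgt A) (yX : RepMaps K src tgt X)
    (f : ∀ v, A v →ₗ[K] V v) (hf : ∀ v, Function.Injective (f v)) (hfx : f ∈ repHom xA x)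
    (g : ∀ v, W v →ₗ[K] X v) (hg : ∀ v, Function.Surjective (g v)) (hgy : g ∈ repHom y yX) :
    -eulerForm src tgt (dimVec K A) (dimVec K X) ≤ extDim x y := by
  let π : (∀ a, V (src a) →ₗ[K] W (tgt a)) →ₗ[K] (∀ a, A (src a) →ₗ[K] X (tgt a)) :=
    LinearMap.pi fun a =>
      (LinearMap.compRight K (g (tgt a)) ∘ₗ LinearMap.lcomp K (W (tgt a)) (f (src a))) ∘ₗ
        LinearMap.proj a
  have hπapp : ∀ ψ a m, π ψ a m = g (tgt a) (ψ a (f (src a) m)) := fun _ _ _ => rfl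
  have hπ : Function.Surjective π := by
    intro ψ
    choose p hp using fun v => (f v).exists_leftInverse_of_injective
      (LinearMap.ker_eq_bot.2 (hf v))
    choose q hq using fun v => (g v).exists_rightInverse_of_surjective
      (LinearMap.range_eq_top.2 (hg v))
    refine ⟨fun a => q (tgt a) ∘ₗ ψ a ∘ₗ p (src a), ?_⟩
    ext a m
    rw [hπapp]
    have h1 : p (src a) (f (src a) m) = m := LinearMap.congr_fun (hp _) m
    have h2 : ∀ z, g (tgt a) (q (tgt a) z) = z := fun z => LinearMap.congr_fun (hq _) z
    simp [h1, h2]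
  have hle : (LinearMap.range (repDiff x y)).map π ≤ LinearMap.range (repDiff xA yX) := by
    rintro _ ⟨_, ⟨φ, rfl⟩, rfl⟩
    refine ⟨fun v => g v ∘ₗ φ v ∘ₗ f v, ?_⟩
    ext a m
    rw [hπapp]
    change g (tgt a) (φ _ (f _ (xA a m))) - yX a (g _ (φ _ (f _ m))) =
      g _ (φ _ (x a (f _ m)) - y a (φ _ (f _ m)))
    rw [mem_repHom.1 hfx, ← mem_repHom.1 hgy, map_sub]
  have h1 := Submodule.finrank_mono hle
  have h2 := LinearMap.finrank_range_add_finrank_ker (repDiff xA yX)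
  have h3 := LinearMap.finrank_range_add_finrank_ker π
  rw [LinearMap.range_eq_top.2 hπ, finrank_top] at h3
  set R := LinearMap.range (repDiff x y) with hR
  have h4 := LinearMap.finrank_range_add_finrank_ker (π.domRestrict R)
  have h5 : finrank K (LinearMap.ker (π.domRestrict R)) ≤ finrank K (LinearMap.ker π) := by
    refine LinearMap.finrank_le_finrank_of_injective
      (f := (R.subtype.restrict (p := LinearMap.ker (π.domRestrict R))
        (q := LinearMap.ker π) fun z hz => hz)) ?_
    intro a b hab
    have hval := congrArg Subtype.val hab
    exact Subtype.ext (Subtype.ext hval)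
  have h6 : LinearMap.range (π.domRestrict R) = R.map π := by
    rw [LinearMap.domRestrict, LinearMap.range_comp, Submodule.range_subtype]
  rw [h6] at h4
  rw [extDim_eq, eulerForm_dimVec, ← hR]
  omega

end Representations

section AdaptedBases

variable {K V : Type} [Field K] [AddCommGroup V] [Module K V]

/-- A basis `e` of `V`, after splitting its index set, becomes adapted to a subspace `S` upon
subtracting from some of its members suitable combinations of the remaining ones. -/
theorem exists_adaptedBasis {I : Type} [Fintype I] (e : Basis I K V) (S : Submodule K V) :
    ∃ (I₀ I₁ : Type) (_ : Fintype I₀) (_ : Fintype I₁) (σ : I₀ ⊕ I₁ ≃ I) (B : I₁ → I₀ → K)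
      (e' : Basis (I₀ ⊕ I₁) K V) (b₀ : Basis I₀ K S) (b₁ : Basis I₁ K (V ⧸ S)),
      (∀ i, e' (Sum.inr i) = e (σ (Sum.inr i))) ∧
      (∀ j, e' (Sum.inl j) = e (σ (Sum.inl j)) - ∑ i, B i j • e (σ (Sum.inr i))) ∧
      (∀ j, e' (Sum.inl j) = b₀ j) ∧ (∀ i, S.mkQ (e' (Sum.inr i)) = b₁ i) := by
  classical
  have := Module.Finite.of_basis e
  obtain ⟨I₁, a, ha, hspan, hli⟩ := exists_linearIndependent' K (S.mkQ ∘ e)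
  have : Finite I₁ := Finite.of_injective a ha
  have hI₁ : Fintype I₁ := Fintype.ofFinite I₁
  have htop : span K (Set.range (S.mkQ ∘ e)) = ⊤ := by
    rw [Set.range_comp, ← Submodule.map_span, e.span_eq, Submodule.map_top, Submodule.range_mkQ]
  let b₁ : Basis I₁ K (V ⧸ S) := Basis.mk hli (by rw [hspan, htop])
  have hb₁ : ∀ i, b₁ i = S.mkQ (e (a i)) := fun i => by simp [b₁]
  let I₀ := {i // i ∉ Set.range a}
  let σ : I₀ ⊕ I₁ ≃ I := (Equiv.sumComm _ _).trans
    (((Equiv.ofInjective a ha).sumCongr (Equiv.refl _)).trans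
      (Equiv.Set.sumCompl (Set.range a)))
  have hσr : ∀ i, σ (Sum.inr i) = a i := fun i => rfl
  let B : I₁ → I₀ → K := fun i j => b₁.repr (S.mkQ (e (σ (Sum.inl j)))) i
  let w : I₀ ⊕ I₁ → V := Sum.elim
    (fun j => e (σ (Sum.inl j)) - ∑ i, B i j • e (σ (Sum.inr i))) (fun i => e (σ (Sum.inr i)))
  have hwS : ∀ j, w (Sum.inl j) ∈ S := fun j => by
    rw [← Submodule.ker_mkQ S, LinearMap.mem_ker]
    have h := b₁.sum_repr (S.mkQ (e (σ (Sum.inl j))))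
    change S.mkQ (e (σ (Sum.inl j)) - ∑ i, B i j • e (σ (Sum.inr i))) = 0
    rw [map_sub, map_sum, sub_eq_zero, ← h]
    refine Finset.sum_congr rfl fun i _ => ?_
    rw [map_smul, hσr, hb₁]
  have hw : ⊤ ≤ span K (Set.range w) := by
    rw [← e.span_eq, span_le]
    have hr : ∀ i, e (σ (Sum.inr i)) ∈ span K (Set.range w) := fun i =>
      subset_span ⟨Sum.inr i, rfl⟩
    rintro _ ⟨i, rfl⟩
    obtain ⟨i | i, rfl⟩ := σ.surjective i
    · have h1 : w (Sum.inl i) ∈ span K (Set.range w) := subset_span ⟨_, rfl⟩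
      have h2 := add_mem h1 (sum_mem (t := Finset.univ) fun l _ => smul_mem _ (B l i) (hr l))
      change e (σ (Sum.inl i)) - _ + _ ∈ _ at h2
      rwa [sub_add_cancel] at h2
    · exact hr i
  have hcard : Fintype.card (I₀ ⊕ I₁) = finrank K V := by
    rw [finrank_eq_card_basis e, Fintype.card_congr σ]
  let e' : Basis (I₀ ⊕ I₁) K V := Basis.mk
    (linearIndependent_of_top_le_span_of_card_eq_finrank hw hcard) hw
  have he' : ∀ i, e' i = w i := fun i => by simp [e']
  let w₀ : I₀ → S := fun j => ⟨w (Sum.inl j), hwS j⟩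
  have hw₀ : LinearIndependent K w₀ := by
    apply LinearIndependent.of_comp S.subtype
    have h := e'.linearIndependent.comp Sum.inl Sum.inl_injective
    convert h using 1
    ext j
    simp [w₀, he']
  have hc₀ : Fintype.card I₀ = finrank K S := by
    have h1 := Submodule.finrank_quotient_add_finrank S
    rw [finrank_eq_card_basis b₁] at h1
    rw [Fintype.card_sum] at hcard
    omega
  refine ⟨I₀, I₁, inferInstance, hI₁, σ, B, e',
    Basis.mk hw₀ (hw₀.span_eq_top_of_card_eq_finrank' hc₀).ge, b₁,
    fun i => he' _, fun j => he' _, fun j => ?_, fun i => ?_⟩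
  · rw [he', Basis.mk_apply]
  · rw [he', hb₁]; rfl

end AdaptedBases

section Rationality

variable {k Ω V W : Type} [Field k] [Field Ω] [Algebra k Ω] [AddCommGroup V] [Module Ω V]
  [AddCommGroup W] [Module Ω W] {I J L : Type}

/-- The coordinates of `u` in the basis `e` lie in the subfield `E`. -/
def IsRatl (E : IntermediateField k Ω) (e : Basis I Ω V) (u : V) : Prop :=
  ∀ i, e.repr u i ∈ E

variable {E : IntermediateField k Ω} {e : Basis I Ω V} {e' : Basis J Ω V} {f : Basis L Ω W}

theorem IsRatl.self (e : Basis I Ω V) (i : I) : IsRatl E e (e i) := fun j => by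
  classical
  rw [e.repr_self, Finsupp.single_apply]
  split_ifs
  exacts [one_mem _, zero_mem _]

theorem IsRatl.smul {u : V} (hu : IsRatl E e u) {c : Ω} (hc : c ∈ E) : IsRatl E e (c • u) :=
  fun i => by simpa using mul_mem hc (hu i)

theorem IsRatl.sub {u v : V} (hu : IsRatl E e u) (hv : IsRatl E e v) : IsRatl E e (u - v) :=
  fun i => by simpa using sub_mem (hu i) (hv i)

theorem IsRatl.sum {T : Type} {s : Finset T} {u : T → V} (hu : ∀ t ∈ s, IsRatl E e (u t)) :
    IsRatl E e (∑ t ∈ s, u t) := fun i => by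
  simpa [Finsupp.finsetSum_apply] using sum_mem fun t ht => hu t ht i

theorem IsRatl.map [Fintype I] {T : V →ₗ[Ω] W} (hT : ∀ i, IsRatl E f (T (e i))) {u : V}
    (hu : IsRatl E e u) : IsRatl E f (T u) := by
  rw [← e.sum_repr u, map_sum]
  exact IsRatl.sum fun i _ => by rw [map_smul]; exact (hT i).smul (hu i)

theorem IsRatl.unchange [Fintype J] {u : V} (hu : IsRatl E e' u)
    (he : ∀ j, IsRatl E e (e' j)) :
    IsRatl E e u := IsRatl.map (T := LinearMap.id) he hu

theorem IsRatl.change [Fintype I] [Fintype J] {u : V} (hu : IsRatl E e u) (he : ∀ j, IsRatl E e (e' j)) :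
    IsRatl E e' u := by
  classical
  let σ := e.indexEquiv e'
  let P : Matrix I I E := Matrix.of fun i j => ⟨e.repr (e' (σ j)) i, he _ i⟩
  let ι' := algebraMap E Ω
  have hP : P.map ι' = e.toMatrix (e'.reindex σ.symm) := by
    ext i j
    simp [P, Basis.toMatrix_apply, ι']
  have hunit : IsUnit (P.map ι') := by
    rw [hP]
    have := e.invertibleToMatrix (e'.reindex σ.symm)
    exact isUnit_of_invertible _
  have hdet : IsUnit P.det := by
    have h1 := (Matrix.isUnit_iff_isUnit_det _).1 hunit
    have h2 : (P.map ι').det = ι' P.det := by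
      rw [RingHom.map_det]; rfl
    rw [h2, isUnit_iff_ne_zero] at h1
    rw [isUnit_iff_ne_zero]
    exact fun h => h1 (by rw [h, map_zero])
  let b : I → E := fun i => ⟨e.repr u i, hu i⟩
  let c : I → E := P⁻¹.mulVec b
  have hc : P.mulVec c = b := by
    rw [Matrix.mulVec_mulVec, Matrix.mul_nonsing_inv _ hdet, Matrix.one_mulVec]
  have hc' : (P.map ι').mulVec (ι' ∘ c) = ι' ∘ b := by
    rw [← hc]
    ext i
    exact (RingHom.map_mulVec ι' P c i).symm
  have hr : (P.map ι').mulVec (fun i => e'.repr u (σ i)) = ι' ∘ b := by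
    rw [hP]
    ext i
    have := congrFun ((e'.reindex σ.symm).toMatrix_mulVec_repr e u) i
    have hrepr : ⇑((e'.reindex σ.symm).repr u) = fun i => e'.repr u (σ i) :=
      funext fun i => by rw [Basis.repr_reindex_apply, Equiv.symm_symm]
    rw [hrepr] at this
    exact this
  have hinj := Matrix.mulVec_injective_of_isUnit hunit (hr.trans hc'.symm)
  intro j
  have h := congrFun hinj (σ.symm j)
  simp only [Equiv.apply_symm_apply, Function.comp_apply] at h
  rw [h]
  exact (c _).2

end Rationality

section AdaptedBases

variable {K V : Type} [Field K] [AddCommGroup V] [Module K V]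

/-- A basis of a subspace and lifts of a basis of the quotient together form a basis. -/
theorem exists_basis_sum {I₀ I₁ : Type} [Fintype I₀] [Fintype I₁] {S : Submodule K V}
    (b₀ : Basis I₀ K S) (b₁ : Basis I₁ K (V ⧸ S)) (u : I₁ → V) (hu : ∀ i, S.mkQ (u i) = b₁ i) :
    ∃ e : Basis (I₀ ⊕ I₁) K V, (∀ j, e (Sum.inl j) = b₀ j) ∧ ∀ i, e (Sum.inr i) = u i := by
  let w : I₀ ⊕ I₁ → V := Sum.elim (fun j => b₀ j) u
  have hli : LinearIndependent K w := by
    refine LinearIndependent.sum_type (b₀.linearIndependent.map' S.subtype S.ker_subtype) ?_ ?_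
    · apply LinearIndependent.of_comp S.mkQ
      have hcomp : S.mkQ ∘ u = b₁ := funext hu
      change LinearIndependent K (S.mkQ ∘ u)
      rw [hcomp]
      exact b₁.linearIndependent
    · rw [Submodule.disjoint_def]
      intro z hz hz'
      have hzS : z ∈ S := by
        have : span K (Set.range fun j => (b₀ j : V)) ≤ S := by
          rw [span_le]; rintro _ ⟨j, rfl⟩; exact (b₀ j).2
        exact this hz
      obtain ⟨c, rfl⟩ := (Submodule.mem_span_range_iff_exists_fun K).1 hz'
      have h0 : S.mkQ (∑ i, c i • u i) = 0 := by
        rwa [← LinearMap.mem_ker, Submodule.ker_mkQ]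
      simp only [map_sum, map_smul, hu] at h0
      have := Fintype.linearIndependent_iff.1 b₁.linearIndependent c h0
      simp [this]
  have hsp : ⊤ ≤ span K (Set.range w) := by
    intro z _
    have h1 := b₁.sum_repr (S.mkQ z)
    have hz : z - ∑ i, b₁.repr (S.mkQ z) i • u i ∈ S := by
      rw [← Submodule.Quotient.mk_eq_zero S, ← Submodule.mkQ_apply, map_sub, map_sum, sub_eq_zero]
      simp only [map_smul, hu]
      exact h1.symm
    have h2 : S = span K (Set.range fun j => (b₀ j : V)) := by
      have := congrArg (Submodule.map S.subtype) b₀.span_eq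
      rw [Submodule.map_span, ← Set.range_comp, Submodule.map_top, Submodule.range_subtype] at this
      exact this.symm
    have h3 : S ≤ span K (Set.range w) := by
      rw [h2]
      exact span_mono (by rintro _ ⟨j, rfl⟩; exact ⟨Sum.inl j, rfl⟩)
    have h4 : ∑ i, b₁.repr (S.mkQ z) i • u i ∈ span K (Set.range w) :=
      sum_mem fun i _ => smul_mem _ _ (subset_span ⟨Sum.inr i, rfl⟩)
    simpa using add_mem (h3 hz) h4
  exact ⟨Basis.mk hli hsp, fun j => by simp [w], fun i => by simp [w]⟩

end AdaptedBases

section GenericRepresentations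

variable {K : Type} [Field K] {ι κ : Type} {src tgt : κ → ι}
  {V : ι → Type} [∀ v, AddCommGroup (V v)] [∀ v, Module K (V v)]
  {N : ι → Type} [∀ v, AddCommGroup (N v)] [∀ v, Module K (N v)]

/-- A family of subspaces is stable under the maps of a representation. -/
def IsSubrep (x : RepMaps K src tgt V) (S : ∀ v, Submodule K (V v)) : Prop :=
  ∀ a, ∀ m ∈ S (src a), x a m ∈ S (tgt a)

/-- The restriction of a representation to a stable family of subspaces. -/
def subRep (x : RepMaps K src tgt V) {S : ∀ v, Submodule K (V v)} (h : IsSubrep x S) :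
    RepMaps K src tgt (fun v => ↥(S v)) :=
  fun a => (x a).restrict (h a)

/-- The quotient of a representation by a stable family of subspaces. -/
def quotRep (x : RepMaps K src tgt V) {S : ∀ v, Submodule K (V v)} (h : IsSubrep x S) :
    RepMaps K src tgt (fun v => V v ⧸ S v) :=
  fun a => (S (src a)).mapQ (S (tgt a)) (x a) (h a)

theorem isSubrep_ker {x : RepMaps K src tgt V} {y : RepMaps K src tgt N}
    {φ : ∀ v, V v →ₗ[K] N v} (hφ : φ ∈ repHom x y) :
    IsSubrep x (fun v => LinearMap.ker (φ v)) := fun a m hm => by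
  rw [LinearMap.mem_ker] at hm ⊢
  rw [mem_repHom.1 hφ, hm, map_zero]

theorem isSubrep_range {x : RepMaps K src tgt V} {y : RepMaps K src tgt N}
    {φ : ∀ v, V v →ₗ[K] N v} (hφ : φ ∈ repHom x y) :
    IsSubrep y (fun v => LinearMap.range (φ v)) := by
  rintro a _ ⟨m, rfl⟩
  exact ⟨x a m, mem_repHom.1 hφ a m⟩

/-- All matrix entries of a representation with respect to given bases. -/
def repEntries {I : ι → Type} (e : ∀ v, Basis (I v) K (V v)) (x : RepMaps K src tgt V) :
    (Σ a, I (tgt a) × I (src a)) → K :=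
  fun p => (e (tgt p.1)).repr (x p.1 (e (src p.1) p.2.2)) p.2.1

variable {k Ω : Type} [Field k] [Field Ω] [Algebra k Ω]
  {M : ι → Type} [∀ v, AddCommGroup (M v)] [∀ v, Module Ω (M v)]
  {N : ι → Type} [∀ v, AddCommGroup (N v)] [∀ v, Module Ω (N v)]

/-- A representation is generic over `k` if all its matrix entries in suitable bases are
algebraically independent over `k`. -/
def GenericRep (k : Type) {Ω : Type} [Field k] [Field Ω] [Algebra k Ω] {M : ι → Type}
    [∀ v, AddCommGroup (M v)] [∀ v, Module Ω (M v)] (x : RepMaps Ω src tgt M) : Prop :=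
  ∃ (I : ι → Type) (_ : ∀ v, Fintype (I v)) (e : ∀ v, Basis (I v) Ω (M v)),
    AlgebraicIndependent k (repEntries e x)

/-- A pair of representations is generic over `k` if all matrix entries of both of them in suitable
bases are algebraically independent over `k`. -/
def GenericPair (k : Type) {Ω : Type} [Field k] [Field Ω] [Algebra k Ω] {M N : ι → Type}
    [∀ v, AddCommGroup (M v)] [∀ v, Module Ω (M v)] [∀ v, AddCommGroup (N v)]
    [∀ v, Module Ω (N v)] (x : RepMaps Ω src tgt M) (y : RepMaps Ω src tgt N) : Prop :=
  ∃ (I J : ι → Type) (_ : ∀ v, Fintype (I v)) (_ : ∀ v, Fintype (J v))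
    (e : ∀ v, Basis (I v) Ω (M v)) (f : ∀ v, Basis (J v) Ω (N v)),
    AlgebraicIndependent k (Sum.elim (repEntries e x) (repEntries f y))

theorem GenericPair.left {x : RepMaps Ω src tgt M} {y : RepMaps Ω src tgt N}
    (h : GenericPair k x y) : GenericRep k x := by
  obtain ⟨I, J, hI, hJ, e, f, h⟩ := h
  have := h.comp Sum.inl Sum.inl_injective
  rw [Sum.elim_comp_inl] at this
  exact ⟨I, hI, e, this⟩

theorem GenericPair.right {x : RepMaps Ω src tgt M} {y : RepMaps Ω src tgt N}
    (h : GenericPair k x y) : GenericRep k y := by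
  obtain ⟨I, J, hI, hJ, e, f, h⟩ := h
  have := h.comp Sum.inr Sum.inr_injective
  rw [Sum.elim_comp_inr] at this
  exact ⟨J, hJ, f, this⟩

theorem repEntries_mem {I I' : ι → Type} [∀ v, Fintype (I v)] [∀ v, Fintype (I' v)]
    {E : IntermediateField k Ω} {e : ∀ v, Basis (I v) Ω (M v)} {e' : ∀ v, Basis (I' v) Ω (M v)}
    {x : RepMaps Ω src tgt M} (he : ∀ v i, IsRatl E (e v) (e' v i))
    (hx : ∀ a i, IsRatl E (e (tgt a)) (x a (e' (src a) i))) (p) : repEntries e x p ∈ E :=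
  ((IsRatl.self (e _) _).change (he _)).map (hx p.1) p.2.1

variable [Fintype ι] [Fintype κ]

/-- Generic representations have no subrepresentations violating the expected inequality. -/
theorem GenericRep.eulerForm_nonneg {x : RepMaps Ω src tgt M} (hx : GenericRep k x)
    {S : ∀ v, Submodule Ω (M v)} (hS : IsSubrep x S) :
    0 ≤ eulerForm src tgt (dimVec Ω fun v => ↥(S v))
      (dimVec Ω M - dimVec Ω fun v => ↥(S v)) := by
  obtain ⟨I, _, e, hx⟩ := hx
  choose I₀ I₁ _ _ σ B e' b₀ b₁ her hel hb₀ hb₁ using fun v => exists_adaptedBasis (e v) (S v)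
  let w : (Σ v, I₁ v × I₀ v) ⊕ (Σ a, I₀ (tgt a) × I₀ (src a)) ⊕ (Σ a, I (tgt a) × I₁ (src a)) → Ω :=
    Sum.elim (fun p => B p.1 p.2.1 p.2.2) (Sum.elim (repEntries b₀ (subRep x hS))
      fun p => (e (tgt p.1)).repr (x p.1 (e' (src p.1) (Sum.inr p.2.2))) p.2.1)
  set E := IntermediateField.adjoin k (Set.range w)
  have hw : ∀ p, w p ∈ E := fun p => IntermediateField.subset_adjoin _ _ ⟨p, rfl⟩
  have he : ∀ v i, IsRatl E (e v) (e' v i) := by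
    rintro v (j | i)
    · rw [hel]
      exact (IsRatl.self _ _).sub (IsRatl.sum fun i _ => (IsRatl.self _ _).smul
        (hw (Sum.inl ⟨v, i, j⟩)))
    · rw [her]
      exact IsRatl.self _ _
  have hxe : ∀ a i, IsRatl E (e (tgt a)) (x a (e' (src a) i)) := by
    rintro a (j | i)
    · have h1 : x a (e' (src a) (Sum.inl j)) = (S (tgt a)).subtype (subRep x hS a (b₀ _ j)) := by
        rw [hb₀]; rfl
      rw [h1]
      refine IsRatl.map (e := b₀ (tgt a)) (fun i => ?_) fun i => hw (Sum.inr (Sum.inl ⟨a, i, j⟩))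
      rw [Submodule.subtype_apply, ← hb₀]
      exact he _ _
    · exact fun l => hw (Sum.inr (Sum.inr ⟨a, l, i⟩))
  have hcard := (algebraicIndependent_of_mem_adjoin hx (repEntries_mem he hxe)).1
  have hd : ∀ v, dimVec Ω M v = Fintype.card (I v) := fun v => by
    rw [dimVec, finrank_eq_card_basis (e v)]
  have hd₀ : ∀ v, dimVec Ω (fun v => ↥(S v)) v = Fintype.card (I₀ v) := fun v => by
    rw [dimVec, finrank_eq_card_basis (b₀ v)]
  have hI : ∀ v, Fintype.card (I v) = Fintype.card (I₀ v) + Fintype.card (I₁ v) := fun v => by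
    rw [← Fintype.card_congr (σ v), Fintype.card_sum]
  simp only [Fintype.card_sum, Fintype.card_sigma, Fintype.card_prod, hI] at hcard
  zify at hcard
  simp only [eulerForm, Pi.sub_apply, hd, hd₀, hI, Nat.cast_add, add_sub_cancel_left]
  rw [sub_nonneg]
  simp only [add_mul, mul_add, Finset.sum_add_distrib] at hcard ⊢
  simp only [mul_comm] at hcard ⊢
  linarith

end GenericRepresentations

section GenericMorphisms

variable {ι κ : Type} {src tgt : κ → ι} {k Ω : Type} [Field k] [Field Ω] [Algebra k Ω]
  {M : ι → Type} [∀ v, AddCommGroup (M v)] [∀ v, Module Ω (M v)]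
  {N : ι → Type} [∀ v, AddCommGroup (N v)] [∀ v, Module Ω (N v)]
  [Fintype ι] [Fintype κ]

/-- The parameter count for a morphism between generic representations some of whose
coordinates, indexed by `D`, are generic too. -/
theorem genericPair_of_hom {I J : ι → Type} [∀ v, Fintype (I v)] [∀ v, Fintype (J v)]
    (e : ∀ v, Basis (I v) Ω (M v)) (f : ∀ v, Basis (J v) Ω (N v))
    {x : RepMaps Ω src tgt M} {y : RepMaps Ω src tgt N} {φ : ∀ v, M v →ₗ[Ω] N v}
    (hφ : φ ∈ repHom x y) {D : Type} [Fintype D] (pos : D → Σ v, J v × I v)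
    (hind : AlgebraicIndependent k (Sum.elim (Sum.elim (repEntries e x) (repEntries f y))
      fun p => (f (pos p).1).repr (φ (pos p).1 (e (pos p).1 (pos p).2.2)) (pos p).2.1)) :
    (Fintype.card D : ℤ) ≤
        eulerForm src tgt (dimVec Ω fun v => ↥(LinearMap.ker (φ v)))
          (dimVec Ω fun v => ↥(LinearMap.range (φ v))) +
        eulerForm src tgt (dimVec Ω fun v => ↥(LinearMap.range (φ v))) (dimVec Ω N) ∧
      (eulerForm src tgt (dimVec Ω fun v => ↥(LinearMap.ker (φ v)))
          (dimVec Ω fun v => ↥(LinearMap.range (φ v))) +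
        eulerForm src tgt (dimVec Ω fun v => ↥(LinearMap.range (φ v))) (dimVec Ω N) ≤
          (Fintype.card D : ℤ) →
        GenericPair k (subRep x (isSubrep_ker hφ)) (subRep y (isSubrep_range hφ)) ∧
        GenericPair k (subRep y (isSubrep_range hφ)) (quotRep y (isSubrep_range hφ))) := by
  choose I₀ I₁ hI₀ hI₁ σ B e' b₀ b₁ her hel hb₀ hb₁ using
    fun v => exists_adaptedBasis (e v) (LinearMap.ker (φ v))
  choose J₀ L hJ₀ hL τ C f'' c₀ c₁ hfr hfl hc₀ hc₁ using
    fun v => exists_adaptedBasis (f v) (LinearMap.range (φ v))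
  let g : ∀ v, Basis (I₁ v) Ω (LinearMap.range (φ v)) := fun v =>
    (b₁ v).map (φ v).quotKerEquivRange
  have hg : ∀ v i, (g v i : N v) = φ v (e' v (Sum.inr i)) := fun v i => by
    simp only [g, Basis.map_apply, ← hb₁, Submodule.mkQ_apply]
    exact LinearMap.quotKerEquivRange_apply_mk _ _
  choose f' hf'l hf'r using fun v => exists_basis_sum (g v) (c₁ v) (fun i => f'' v (Sum.inr i))
    (hc₁ v)
  have hφl : ∀ v j, φ v (e' v (Sum.inl j)) = 0 := fun v j => by
    rw [hb₀]; exact (b₀ v j).2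
  let w : (Σ v, I₁ v × I₀ v) ⊕ (Σ v, J v × I₁ v) ⊕ (Σ a, I₀ (tgt a) × I₀ (src a)) ⊕
      (Σ a, (I₀ (tgt a) ⊕ I₁ (tgt a)) × I₁ (src a)) ⊕
      (Σ a, (I₁ (tgt a) ⊕ L (tgt a)) × L (src a)) → Ω :=
    Sum.elim (fun p => B p.1 p.2.1 p.2.2) <|
    Sum.elim (fun p => (f p.1).repr (φ p.1 (e' p.1 (Sum.inr p.2.2))) p.2.1) <|
    Sum.elim (repEntries b₀ (subRep x (isSubrep_ker hφ))) <|
    Sum.elim (fun p => (e' (tgt p.1)).repr (x p.1 (e' (src p.1) (Sum.inr p.2.2))) p.2.1)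
      (fun p => (f' (tgt p.1)).repr (y p.1 (f' (src p.1) (Sum.inr p.2.2))) p.2.1)
  set E := IntermediateField.adjoin k (Set.range w)
  have hw : ∀ p, w p ∈ E := fun p => IntermediateField.subset_adjoin _ _ ⟨p, rfl⟩
  have he : ∀ v i, IsRatl E (e v) (e' v i) := by
    rintro v (j | i)
    · rw [hel]
      exact (IsRatl.self _ _).sub (IsRatl.sum fun i _ => (IsRatl.self _ _).smul
        (hw (Sum.inl ⟨v, i, j⟩)))
    · rw [her]
      exact IsRatl.self _ _
  have hφr : ∀ v i, IsRatl E (f v) (φ v (e' v i)) := by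
    rintro v (j | i)
    · rw [hφl]
      exact fun l => by simp
    · exact fun l => hw (Sum.inr (Sum.inl ⟨v, l, i⟩))
  have hxe' : ∀ a i, IsRatl E (e' (tgt a)) (x a (e' (src a) i)) := by
    rintro a (j | i)
    · have h1 : x a (e' (src a) (Sum.inl j)) = (LinearMap.ker (φ (tgt a))).subtype
          (subRep x (isSubrep_ker hφ) a (b₀ _ j)) := by
        rw [hb₀]; rfl
      rw [h1]
      refine IsRatl.map (e := b₀ (tgt a)) (fun i => ?_)
        fun i => hw (Sum.inr (Sum.inr (Sum.inl ⟨a, i, j⟩)))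
      rw [Submodule.subtype_apply, ← hb₀]
      exact IsRatl.self _ _
    · exact fun l => hw (Sum.inr (Sum.inr (Sum.inr (Sum.inl ⟨a, l, i⟩))))
  have hxe : ∀ a i, IsRatl E (e (tgt a)) (x a (e' (src a) i)) := fun a i =>
    (hxe' a i).unchange (he _)
  have hf : ∀ v i, IsRatl E (f v) (f' v i) := by
    rintro v (j | i)
    · rw [hf'l, hg]
      exact hφr _ _
    · rw [hf'r, hfr]
      exact IsRatl.self _ _
  have hyf : ∀ a i, IsRatl E (f (tgt a)) (y a (f' (src a) i)) := by
    rintro a (j | i)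
    · rw [hf'l, hg, ← mem_repHom.1 hφ]
      exact (hxe' a _).map (hφr _)
    · have : IsRatl E (f' (tgt a)) (y a (f' (src a) (Sum.inr i))) :=
        fun l => hw (Sum.inr (Sum.inr (Sum.inr (Sum.inr ⟨a, l, i⟩))))
      exact this.unchange (hf _)
  have hmem : ∀ p, Sum.elim (Sum.elim (repEntries e x) (repEntries f y))
      (fun p => (f (pos p).1).repr (φ (pos p).1 (e (pos p).1 (pos p).2.2)) (pos p).2.1) p ∈ E := by
    rintro ((p | p) | p)
    · exact repEntries_mem he hxe p
    · exact repEntries_mem hf hyf p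
    · exact ((IsRatl.self (e _) _).change (he _)).map (hφr _) _
  obtain ⟨hcard, hcard'⟩ := algebraicIndependent_of_mem_adjoin hind hmem
  have hdN : ∀ v, dimVec Ω N v = Fintype.card (J v) := fun v => by
    rw [dimVec, finrank_eq_card_basis (f v)]
  have hdS : ∀ v, dimVec Ω (fun v => ↥(LinearMap.ker (φ v))) v = Fintype.card (I₀ v) := fun v => by
    rw [dimVec, finrank_eq_card_basis (b₀ v)]
  have hdW : ∀ v, dimVec Ω (fun v => ↥(LinearMap.range (φ v))) v = Fintype.card (I₁ v) :=
    fun v => by rw [dimVec, finrank_eq_card_basis (g v)]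
  have hI : ∀ v, Fintype.card (I v) = Fintype.card (I₀ v) + Fintype.card (I₁ v) := fun v => by
    rw [← Fintype.card_congr (σ v), Fintype.card_sum]
  have hJ : ∀ v, Fintype.card (J v) = Fintype.card (I₁ v) + Fintype.card (L v) := fun v => by
    rw [← Fintype.card_sum, Fintype.card_congr ((f v).indexEquiv (f' v))]
  have hcount : (Fintype.card ((((Σ a, I (tgt a) × I (src a)) ⊕
        (Σ a, J (tgt a) × J (src a))) ⊕ D)) : ℤ) +
      (eulerForm src tgt (dimVec Ω fun v => ↥(LinearMap.ker (φ v)))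
          (dimVec Ω fun v => ↥(LinearMap.range (φ v))) +
        eulerForm src tgt (dimVec Ω fun v => ↥(LinearMap.range (φ v))) (dimVec Ω N)) =
      (Fintype.card ((Σ v, I₁ v × I₀ v) ⊕ (Σ v, J v × I₁ v) ⊕ (Σ a, I₀ (tgt a) × I₀ (src a)) ⊕
      (Σ a, (I₀ (tgt a) ⊕ I₁ (tgt a)) × I₁ (src a)) ⊕
      (Σ a, (I₁ (tgt a) ⊕ L (tgt a)) × L (src a))) : ℤ) + (Fintype.card D : ℤ) := by
    simp only [eulerForm, hdN, hdS, hdW, Fintype.card_sum, Fintype.card_sigma, Fintype.card_prod,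
      hI, hJ]
    push_cast
    simp only [add_mul, mul_add, Finset.sum_add_distrib]
    simp only [mul_comm]
    ring
  have hgrepr : ∀ v (m : M v) (u : LinearMap.range (φ v)), (u : N v) = φ v m → ∀ i,
      (g v).repr u i = (e' v).repr m (Sum.inr i) := by
    intro v m u hu i
    have h1 : u = ∑ i, (e' v).repr m (Sum.inr i) • g v i := by
      apply Subtype.ext
      rw [hu, ← (e' v).sum_repr m, map_sum, Fintype.sum_sum_type]
      simp [hφl, hg]
    rw [h1, (g v).repr_sum_self]
  have hcrepr : ∀ v (z : N v) i, (c₁ v).repr (Submodule.Quotient.mk z) i =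
      (f' v).repr z (Sum.inr i) := by
    intro v z i
    have h1 : (LinearMap.range (φ v)).mkQ z = ∑ i, (f' v).repr z (Sum.inr i) • c₁ v i := by
      conv_lhs => rw [← (f' v).sum_repr z, map_sum, Fintype.sum_sum_type]
      have h2 : ∀ j, (LinearMap.range (φ v)).mkQ (f' v (Sum.inl j)) = 0 := fun j => by
        rw [hf'l, Submodule.mkQ_apply, Submodule.Quotient.mk_eq_zero]
        exact (g v j).2
      simp only [map_smul, h2, smul_zero, Finset.sum_const_zero, zero_add, hf'r, hc₁]
    rw [← Submodule.mkQ_apply, h1, (c₁ v).repr_sum_self]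
  have hgentry : ∀ a i j, repEntries g (subRep y (isSubrep_range hφ)) ⟨a, i, j⟩ =
      (e' (tgt a)).repr (x a (e' (src a) (Sum.inr j))) (Sum.inr i) := fun a i j => by
    refine hgrepr _ _ _ ?_ _
    rw [mem_repHom.1 hφ, ← hg]
    rfl
  refine ⟨by omega, fun hle => ?_⟩
  have hw' := hcard' (by omega)
  constructor
  · refine ⟨I₀, I₁, hI₀, hI₁, b₀, g, ?_⟩
    let ψ : (Σ a, I₀ (tgt a) × I₀ (src a)) ⊕ (Σ a, I₁ (tgt a) × I₁ (src a)) →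
        (Σ v, I₁ v × I₀ v) ⊕ (Σ v, J v × I₁ v) ⊕ (Σ a, I₀ (tgt a) × I₀ (src a)) ⊕
        (Σ a, (I₀ (tgt a) ⊕ I₁ (tgt a)) × I₁ (src a)) ⊕
        (Σ a, (I₁ (tgt a) ⊕ L (tgt a)) × L (src a)) :=
      Sum.elim (fun p => Sum.inr (Sum.inr (Sum.inl p)))
        (fun p => Sum.inr (Sum.inr (Sum.inr (Sum.inl ⟨p.1, Sum.inr p.2.1, p.2.2⟩))))
    have hψ : Function.Injective ψ := by
      rintro (⟨a, i, j⟩ | ⟨a, i, j⟩) (⟨a', i', j'⟩ | ⟨a', i', j'⟩) h <;> cases h <;> rfl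
    have h := hw'.comp ψ hψ
    convert h using 1
    ext (p | ⟨a, i, j⟩)
    · rfl
    · exact hgentry a i j
  · refine ⟨I₁, L, hI₁, hL, g, c₁, ?_⟩
    let ψ : (Σ a, I₁ (tgt a) × I₁ (src a)) ⊕ (Σ a, L (tgt a) × L (src a)) →
        (Σ v, I₁ v × I₀ v) ⊕ (Σ v, J v × I₁ v) ⊕ (Σ a, I₀ (tgt a) × I₀ (src a)) ⊕
        (Σ a, (I₀ (tgt a) ⊕ I₁ (tgt a)) × I₁ (src a)) ⊕
        (Σ a, (I₁ (tgt a) ⊕ L (tgt a)) × L (src a)) :=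
      Sum.elim (fun p => Sum.inr (Sum.inr (Sum.inr (Sum.inl ⟨p.1, Sum.inr p.2.1, p.2.2⟩))))
        (fun p => Sum.inr (Sum.inr (Sum.inr (Sum.inr ⟨p.1, Sum.inr p.2.1, p.2.2⟩))))
    have hψ : Function.Injective ψ := by
      rintro (⟨a, i, j⟩ | ⟨a, i, j⟩) (⟨a', i', j'⟩ | ⟨a', i', j'⟩) h <;> cases h <;> rfl
    have h := hw'.comp ψ hψ
    convert h using 1
    ext (⟨a, i, j⟩ | ⟨a, i, j⟩)
    · exact hgentry a i j
    · change (c₁ (tgt a)).repr (quotRep y (isSubrep_range hφ) a (c₁ (src a) j)) i =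
        (f' (tgt a)).repr (y a (f' (src a) (Sum.inr j))) (Sum.inr i)
      rw [hf'r, ← hc₁, ← hcrepr]
      rfl

end GenericMorphisms

section GenericMorphisms

theorem dimVec_quotient {K : Type} [Field K] {ι : Type} {V : ι → Type}
    [∀ v, AddCommGroup (V v)] [∀ v, Module K (V v)] [∀ v, FiniteDimensional K (V v)]
    (S : ∀ v, Submodule K (V v)) :
    (dimVec K fun v => V v ⧸ S v) = dimVec K V - dimVec K fun v => ↥(S v) := by
  ext v
  have := Submodule.finrank_quotient_add_finrank (S v)
  simp only [dimVec, Pi.sub_apply]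
  omega

theorem dimVec_range {K : Type} [Field K] {ι : Type} {V W : ι → Type}
    [∀ v, AddCommGroup (V v)] [∀ v, Module K (V v)] [∀ v, FiniteDimensional K (V v)]
    [∀ v, AddCommGroup (W v)] [∀ v, Module K (W v)] (φ : ∀ v, V v →ₗ[K] W v) :
    (dimVec K fun v => ↥(LinearMap.range (φ v))) =
      dimVec K V - dimVec K fun v => ↥(LinearMap.ker (φ v)) := by
  ext v
  have := LinearMap.finrank_range_add_finrank_ker (φ v)
  simp only [dimVec, Pi.sub_apply]
  omega

variable {ι κ : Type} {src tgt : κ → ι} {k Ω : Type} [Field k] [Field Ω] [Algebra k Ω]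
  {M : ι → Type} [∀ v, AddCommGroup (M v)] [∀ v, Module Ω (M v)]
  {N : ι → Type} [∀ v, AddCommGroup (N v)] [∀ v, Module Ω (N v)]

theorem subtype_mem_repHom {x : RepMaps Ω src tgt M} {S : ∀ v, Submodule Ω (M v)}
    (hS : IsSubrep x S) : (fun v => (S v).subtype) ∈ repHom (subRep x hS) x :=
  mem_repHom.2 fun _ _ => rfl

theorem mkQ_mem_repHom {x : RepMaps Ω src tgt M} {S : ∀ v, Submodule Ω (M v)}
    (hS : IsSubrep x S) : (fun v => (S v).mkQ) ∈ repHom x (quotRep x hS) :=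
  mem_repHom.2 fun _ _ => rfl

variable [∀ v, FiniteDimensional Ω (M v)] [∀ v, FiniteDimensional Ω (N v)]
  [Fintype ι] [Fintype κ]

/-- Between generic representations there is a morphism such that the pairs
(kernel, image) and (image, cokernel) are generic again. -/
theorem GenericPair.exists_hom (hΩ : Cardinal.aleph0 ≤ Algebra.trdeg k Ω)
    {x : RepMaps Ω src tgt M} {y : RepMaps Ω src tgt N} (h : GenericPair k x y) :
    ∃ (φ : ∀ v, M v →ₗ[Ω] N v) (hφ : φ ∈ repHom x y),
      (finrank Ω (repHom x y) : ℤ) =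
        eulerForm src tgt (dimVec Ω fun v => ↥(LinearMap.ker (φ v)))
          (dimVec Ω fun v => ↥(LinearMap.range (φ v))) +
        eulerForm src tgt (dimVec Ω fun v => ↥(LinearMap.range (φ v))) (dimVec Ω N) ∧
      GenericPair k (subRep x (isSubrep_ker hφ)) (subRep y (isSubrep_range hφ)) ∧
      GenericPair k (subRep y (isSubrep_range hφ)) (quotRep y (isSubrep_range hφ)) := by
  classical
  obtain ⟨I, J, _, _, e, f, h⟩ := h
  let Φ : (∀ v, M v →ₗ[Ω] N v) →ₗ[Ω] ((Σ v, J v × I v) → Ω) :=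
    { toFun := fun φ p => (f p.1).repr (φ p.1 (e p.1 p.2.2)) p.2.1
      map_add' := fun φ ψ => by ext p; simp
      map_smul' := fun c φ => by ext p; simp }
  have hΦ : Function.Injective Φ := fun φ ψ hφψ => by
    ext v : 1
    refine (e v).ext fun i => (f v).repr.injective (Finsupp.ext fun j => ?_)
    exact congrFun hφψ ⟨v, j, i⟩
  obtain ⟨D, D₁, _, _, σ, B, e', b₀, b₁, her, hel, hb₀, -⟩ :=
    exists_adaptedBasis (Pi.basisFun Ω (Σ v, J v × I v)) ((repHom x y).map Φ)
  have hD : Fintype.card D = finrank Ω (repHom x y) := by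
    rw [← finrank_eq_card_basis b₀, ← (Submodule.equivMapOfInjective Φ hΦ (repHom x y)).finrank_eq]
  obtain ⟨c, hc⟩ := exists_algebraicIndependent_sumElim hΩ h D
  obtain ⟨φ, hφ, hφc⟩ := (∑ j, c j • b₀ j).2
  have hcoord : ∀ j, Φ φ (σ (Sum.inl j)) = c j := by
    intro j
    rw [hφc]
    simp only [AddSubmonoidClass.coe_finsetSum, coe_smul, ← hb₀, hel, Finset.sum_apply,
      Pi.smul_apply, Pi.sub_apply, Pi.basisFun_apply, Pi.single_apply, σ.injective.eq_iff,
      smul_eq_mul, Sum.inl.injEq, reduceCtorEq, if_false, mul_zero, Finset.sum_const_zero,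
      sub_zero]
    simp
  have hc' : c = fun p => (f (σ (Sum.inl p)).1).repr
      (φ (σ (Sum.inl p)).1 (e (σ (Sum.inl p)).1 (σ (Sum.inl p)).2.2)) (σ (Sum.inl p)).2.1 :=
    funext fun j => (hcoord j).symm
  rw [hc'] at hc
  obtain ⟨h1, h2⟩ := genericPair_of_hom e f hφ (fun j => σ (Sum.inl j)) hc
  have h3 := neg_eulerForm_le_extDim x y (subRep x (isSubrep_ker hφ))
    (quotRep y (isSubrep_range hφ)) _ (fun v => Subtype.val_injective)
    (subtype_mem_repHom (isSubrep_ker hφ)) _ (fun v => Submodule.mkQ_surjective _)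
    (mkQ_mem_repHom (isSubrep_range hφ))
  rw [extDim, dimVec_quotient, eulerForm_sub_right] at h3
  have h4 : eulerForm src tgt (dimVec Ω fun v => ↥(LinearMap.range (φ v))) (dimVec Ω N) =
      eulerForm src tgt (dimVec Ω M) (dimVec Ω N) -
      eulerForm src tgt (dimVec Ω fun v => ↥(LinearMap.ker (φ v))) (dimVec Ω N) := by
    rw [dimVec_range φ, eulerForm_sub_left]
  rw [hD] at h1 h2
  exact ⟨φ, hφ, by linarith, h2 (by linarith)⟩

end GenericMorphisms

section Filtrations

variable {K : Type} [Field K] {ι κ : Type} {src tgt : κ → ι}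
  {V : ι → Type} [∀ v, AddCommGroup (V v)] [∀ v, Module K (V v)]
  {W : ι → Type} [∀ v, AddCommGroup (W v)] [∀ v, Module K (W v)]
  {X : ι → Type} [∀ v, AddCommGroup (X v)] [∀ v, Module K (X v)]

/-- The subrepresentations of `x` obtained from `x` itself by repeatedly passing to the kernel
of a morphism to `y`. -/
inductive IsIterKer (x : RepMaps K src tgt V) (y : RepMaps K src tgt W) :
    (∀ v, Submodule K (V v)) → Prop
  | top : IsIterKer x y fun _ => ⊤
  | step {S : ∀ v, Submodule K (V v)} (hS : IsIterKer x y S) (η : ∀ v, V v →ₗ[K] W v)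
      (hη : ∀ a, ∀ m ∈ S (src a), η (tgt a) (x a m) = y a (η (src a) m)) :
      IsIterKer x y fun v => S v ⊓ LinearMap.ker (η v)

theorem IsIterKer.isSubrep {x : RepMaps K src tgt V} {y : RepMaps K src tgt W}
    {S : ∀ v, Submodule K (V v)} (h : IsIterKer x y S) : IsSubrep x S := by
  induction h with
  | top => exact fun _ _ _ => trivial
  | step hS η hη ih =>
    rintro a m ⟨hm, hm'⟩
    refine ⟨ih a m hm, ?_⟩
    have hm' : η (src a) m = 0 := hm'
    change η (tgt a) (x a m) = 0
    rw [hη a m hm, hm', map_zero]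

theorem IsIterKer.map_subtype {x : RepMaps K src tgt V} {y : RepMaps K src tgt W}
    {S : ∀ v, Submodule K (V v)} (hS : IsIterKer x y S) (hS' : IsSubrep x S)
    {Y : ∀ v, Submodule K (W v)} (hY : IsSubrep y Y) {T : ∀ v, Submodule K (S v)}
    (hT : IsIterKer (subRep x hS') (subRep y hY) T) :
    IsIterKer x y fun v => (T v).map (S v).subtype := by
  induction hT with
  | top => simpa using hS
  | @step T hT η hη ih =>
    choose η' hη' using fun v => LinearMap.exists_extend ((Y v).subtype ∘ₗ η v)
    have hη'' : ∀ v (m : S v), η' v m = η v m := fun v m => LinearMap.congr_fun (hη' v) m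
    convert ih.step η' ?_ using 2 with v
    · ext m
      constructor
      · rintro ⟨m, ⟨hm, hm'⟩, rfl⟩
        refine ⟨⟨m, hm, rfl⟩, ?_⟩
        have hm' : η v m = 0 := hm'
        change η' v m = 0
        rw [hη'', hm']
        rfl
      · rintro ⟨⟨m, hm, rfl⟩, hm'⟩
        refine ⟨m, ⟨hm, ?_⟩, rfl⟩
        have hm' : η' v m = 0 := hm'
        rw [hη''] at hm'
        exact Subtype.ext hm'
    · rintro a _ ⟨m, hm, rfl⟩
      have h1 := hη a m hm
      have h2 := hη'' (tgt a) (subRep x hS' a m)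
      rw [h1] at h2
      change η' (tgt a) (x a m) = y a (η' (src a) m)
      rw [hη'' (src a)]
      exact h2

theorem finrank_inf_ker_add_finrank_map {V W : Type} [AddCommGroup V] [Module K V]
    [AddCommGroup W] [Module K W] [FiniteDimensional K V] (S : Submodule K V) (η : V →ₗ[K] W) :
    finrank K ↥(S ⊓ LinearMap.ker η) + finrank K ↥(S.map η) = finrank K S := by
  have h1 := LinearMap.finrank_range_add_finrank_ker (η.domRestrict S)
  have h2 : LinearMap.range (η.domRestrict S) = S.map η := by
    rw [LinearMap.domRestrict, LinearMap.range_comp, Submodule.range_subtype]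
  have h3 : (LinearMap.ker (η.domRestrict S)).map S.subtype = S ⊓ LinearMap.ker η := by
    rw [LinearMap.domRestrict, LinearMap.ker_comp, Submodule.map_comap_subtype]
  rw [h2] at h1
  rw [← h3, ← (Submodule.equivMapOfInjective _ S.injective_subtype _).finrank_eq]
  omega

variable [Fintype ι] [Fintype κ] [∀ v, FiniteDimensional K (V v)] [∀ v, FiniteDimensional K (W v)]
  [∀ v, FiniteDimensional K (X v)]

theorem IsIterKer.eulerForm_nonneg {x : RepMaps K src tgt V} {y : RepMaps K src tgt W}
    {z : RepMaps K src tgt X} (hyz : extDim y z = 0)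
    {T : ∀ v, Submodule K (V v)} (hT : IsIterKer x y T) :
    0 ≤ eulerForm src tgt (dimVec K V - dimVec K fun v => ↥(T v)) (dimVec K X) := by
  induction hT with
  | top =>
    have : (dimVec K fun v => ↥(⊤ : Submodule K (V v))) = dimVec K V := by
      ext v; simp [dimVec]
    rw [this, sub_self]
    simp [eulerForm]
  | @step S hS η hη ih =>
    have hA : IsSubrep y (fun v => (S v).map (η v)) := by
      rintro a _ ⟨m, hm, rfl⟩
      exact ⟨x a m, hS.isSubrep a m hm, hη a m hm⟩
    have h1 := neg_eulerForm_le_extDim y z (subRep y hA) z _ (fun v => Subtype.val_injective)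
      (subtype_mem_repHom hA) (fun v => LinearMap.id) (fun v => Function.surjective_id)
      (mem_repHom.2 fun _ _ => rfl)
    have h2 : (dimVec K V - dimVec K fun v => ↥(S v ⊓ LinearMap.ker (η v))) =
        (dimVec K V - dimVec K fun v => ↥(S v)) + dimVec K fun v => ↥((S v).map (η v)) := by
      ext v
      have := finrank_inf_ker_add_finrank_map (S v) (η v)
      simp only [dimVec, Pi.sub_apply, Pi.add_apply]
      omega
    rw [h2, eulerForm_add_left]
    linarith

end Filtrations

section GenericFiltrations

variable {ι κ : Type} {src tgt : κ → ι}

theorem dimVec_map_subtype {K : Type} [Field K] {V : ι → Type}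
    [∀ v, AddCommGroup (V v)] [∀ v, Module K (V v)] {S : ∀ v, Submodule K (V v)}
    (T : ∀ v, Submodule K (S v)) :
    (dimVec K fun v => ↥((T v).map (S v).subtype)) = dimVec K fun v => ↥(T v) := by
  ext v
  rw [dimVec, dimVec, ← (Submodule.equivMapOfInjective _ (S v).injective_subtype _).finrank_eq]

theorem IsSubrep.map_subtype {K : Type} [Field K] {V : ι → Type}
    [∀ v, AddCommGroup (V v)] [∀ v, Module K (V v)] {x : RepMaps K src tgt V}
    {S : ∀ v, Submodule K (V v)} {hS : IsSubrep x S}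
    {T : ∀ v, Submodule K (S v)} (hT : IsSubrep (subRep x hS) T) :
    IsSubrep x fun v => (T v).map (S v).subtype := by
  rintro a _ ⟨m, hm, rfl⟩
  exact ⟨subRep x hS a m, hT a m hm, rfl⟩

variable {k Ω : Type} [Field k] [Field Ω] [Algebra k Ω] [Fintype ι] [Fintype κ]

/-- For a generic pair of representations the dimension of the extension group is computed by
an iterated kernel. -/
theorem GenericPair.exists_isIterKer (hΩ : Cardinal.aleph0 ≤ Algebra.trdeg k Ω) (n : ℕ) :
    ∀ {M : ι → Type} [∀ v, AddCommGroup (M v)] [∀ v, Module Ω (M v)]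
      {N : ι → Type} [∀ v, AddCommGroup (N v)] [∀ v, Module Ω (N v)]
      [∀ v, FiniteDimensional Ω (M v)] [∀ v, FiniteDimensional Ω (N v)]
      {x : RepMaps Ω src tgt M} {y : RepMaps Ω src tgt N},
      ∑ v, finrank Ω (M v) + ∑ v, finrank Ω (N v) < n → GenericPair k x y →
      ∃ T : ∀ v, Submodule Ω (M v), IsIterKer x y T ∧
        eulerForm src tgt (dimVec Ω fun v => ↥(T v)) (dimVec Ω M - dimVec Ω fun v => ↥(T v)) = 0 ∧
        extDim x y = -eulerForm src tgt (dimVec Ω fun v => ↥(T v)) (dimVec Ω N) := by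
  induction n with
  | zero => intro M _ _ N _ _ _ _ x y hn; omega
  | succ n ih =>
    intro M _ _ N _ _ _ _ x y hn h
    obtain ⟨φ, hφ, hD, hSW, hWX⟩ := h.exists_hom hΩ
    set S := fun v => LinearMap.ker (φ v) with hS
    set W := fun v => LinearMap.range (φ v) with hW
    have hSx : IsSubrep x S := isSubrep_ker hφ
    have hWy : IsSubrep y W := isSubrep_range hφ
    by_cases hD0 : finrank Ω (repHom x y) = 0
    · refine ⟨fun _ => ⊤, IsIterKer.top, ?_⟩
      have : (dimVec Ω fun v => ↥(⊤ : Submodule Ω (M v))) = dimVec Ω M := by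
        ext v; simp [dimVec]
      rw [this, extDim, hD0]
      simp [eulerForm]
    obtain ⟨v, hv⟩ : ∃ v, 0 < finrank Ω (W v) := by
      by_contra! hcon
      have : (dimVec Ω fun v => ↥(W v)) = 0 := by
        ext v
        simpa [dimVec] using hcon v
      apply hD0
      rw [this] at hD
      simpa [eulerForm] using hD
    have hrn : ∀ v, finrank Ω (W v) + finrank Ω (S v) = finrank Ω (M v) := fun v =>
      LinearMap.finrank_range_add_finrank_ker (φ v)
    have hqn : ∀ v, finrank Ω (N v ⧸ W v) + finrank Ω (W v) = finrank Ω (N v) := fun v =>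
      Submodule.finrank_quotient_add_finrank (W v)
    have hWle := Finset.single_le_sum (f := fun v => finrank Ω (W v)) (fun _ _ => Nat.zero_le _)
      (Finset.mem_univ v)
    simp only [← hrn, ← hqn, Finset.sum_add_distrib] at hn
    have hIter : IsIterKer x y S := by
      have := IsIterKer.top.step φ fun a m _ => mem_repHom.1 hφ a m
      simpa using this
    have hn₀ : ∑ v, finrank Ω (S v) + ∑ v, finrank Ω (W v) < n := by omega
    have hn₁ : ∑ v, finrank Ω (W v) + ∑ v, finrank Ω (N v ⧸ W v) < n := by omega
    obtain ⟨T₀, hT₀, hT₀e, hT₀x⟩ := ih hn₀ hSW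
    obtain ⟨T₁, hT₁, hT₁e, hT₁x⟩ := ih hn₁ hWX
    have hT := hIter.map_subtype hSx hWy hT₀
    have hB := h.left.eulerForm_nonneg hT.isSubrep
    have hB₁ := h.right.eulerForm_nonneg (IsSubrep.map_subtype hT₁.isSubrep)
    rw [dimVec_map_subtype] at hB hB₁
    have hX₀ := extDim_nonneg (subRep x hSx) (subRep y hWy)
    have hX₁ := extDim_nonneg (subRep y hWy) (quotRep y hWy)
    have hdW : (dimVec Ω fun v => ↥(W v)) = dimVec Ω M - dimVec Ω fun v => ↥(S v) :=
      dimVec_range φ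
    have hdX := dimVec_quotient W
    have hXW : extDim (subRep y hWy) (quotRep y hWy) = 0 := by
      rw [hdX, eulerForm_sub_right] at hT₁x
      rw [eulerForm_sub_right] at hB₁ hT₁e
      linarith
    have hpos := hT₀.eulerForm_nonneg hXW
    refine ⟨_, hT, ?_, ?_⟩
    · rw [dimVec_map_subtype]
      rw [hdW, eulerForm_sub_right] at hT₀x
      rw [eulerForm_sub_right] at hB hT₀e ⊢
      linarith
    · have hle := neg_eulerForm_le_extDim x y (subRep x hT.isSubrep) y _
        (fun v => Subtype.val_injective) (subtype_mem_repHom hT.isSubrep)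
        (fun v => LinearMap.id) (fun v => Function.surjective_id) (mem_repHom.2 fun _ _ => rfl)
      rw [dimVec_map_subtype] at hle ⊢
      refine le_antisymm ?_ hle
      have hT₀x' := hT₀x
      rw [hdW, eulerForm_sub_right] at hT₀x
      rw [eulerForm_sub_right] at hB hT₀e
      rw [extDim]
      rw [hdX, hdW] at hpos
      rw [hdW] at hD
      simp only [eulerForm_sub_left, eulerForm_sub_right] at *
      linarith

end GenericFiltrations

section Specialization

/-- A family of functions between fields all of whose identities characterizing ring homomorphisms
hold eventually. -/
structure IsEventualHom {X Ω k : Type} [Field Ω] [Field k] (l : Filter X) (ev : X → Ω → k) :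
    Prop where
  one : ∀ᶠ t in l, ev t 1 = 1
  add : ∀ a b, ∀ᶠ t in l, ev t (a + b) = ev t a + ev t b
  mul : ∀ a b, ∀ᶠ t in l, ev t (a * b) = ev t a * ev t b

/-- The linear map whose matrix is the image of the matrix of `f` under `g`. -/
def spMap {Ω k : Type} [Field Ω] [Field k] (g : Ω → k) {I J : Type} [Fintype I]
    (f : (I → Ω) →ₗ[Ω] (J → Ω)) : (I → k) →ₗ[k] (J → k) :=
  letI := Classical.decEq I
  Matrix.toLin' ((LinearMap.toMatrix' f).map g)

/-- The span of the image under `g` of a basis of `S`. -/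
def spSub {Ω k : Type} [Field Ω] [Field k] (g : Ω → k) {I : Type} [Fintype I]
    (S : Submodule Ω (I → Ω)) : Submodule k (I → k) :=
  span k (Set.range fun i => g ∘ (finBasis Ω S i : I → Ω))

/-- The representation whose matrices are the images of those of `x` under `g`. -/
def spRep {Ω k : Type} [Field Ω] [Field k] (g : Ω → k) {ι κ : Type} {src tgt : κ → ι}
    {I : ι → Type} [∀ v, Fintype (I v)] (x : RepMaps Ω src tgt fun v => I v → Ω) :
    RepMaps k src tgt fun v => I v → k :=
  fun a => spMap g (x a)

namespace IsEventualHom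

variable {X Ω k : Type} [Field Ω] [Field k] {l : Filter X} {ev : X → Ω → k}

theorem zero (h : IsEventualHom l ev) : ∀ᶠ t in l, ev t 0 = 0 := by
  filter_upwards [h.add 0 0] with t ht
  simpa using ht

theorem sum (h : IsEventualHom l ev) {T : Type} (s : Finset T) (c : T → Ω) :
    ∀ᶠ t in l, ev t (∑ i ∈ s, c i) = ∑ i ∈ s, ev t (c i) := by
  classical
  induction s using Finset.induction_on with
  | empty => simpa using h.zero
  | insert i s hi ih =>
    filter_upwards [ih, h.add (c i) (∑ j ∈ s, c j)] with t h1 h2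
    rw [Finset.sum_insert hi, Finset.sum_insert hi, h2, h1]

theorem sub (h : IsEventualHom l ev) (a b : Ω) :
    ∀ᶠ t in l, ev t (a - b) = ev t a - ev t b := by
  filter_upwards [h.add (a - b) b] with t ht
  rw [sub_add_cancel] at ht
  rw [ht, add_sub_cancel_right]

theorem sum_mul (h : IsEventualHom l ev) {T : Type} (s : Finset T) (c d : T → Ω) :
    ∀ᶠ t in l, ev t (∑ i ∈ s, c i * d i) = ∑ i ∈ s, ev t (c i) * ev t (d i) := by
  filter_upwards [h.sum s fun i => c i * d i,
    (Filter.eventually_all_finset s).2 fun i _ => h.mul (c i) (d i)] with t h1 h2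
  rw [h1]
  exact Finset.sum_congr rfl h2

theorem spMap_apply (h : IsEventualHom l ev) {I J : Type} [Fintype I] [Finite J]
    (f : (I → Ω) →ₗ[Ω] (J → Ω)) (u : I → Ω) :
    ∀ᶠ t in l, spMap (ev t) f (ev t ∘ u) = ev t ∘ f u := by
  classical
  filter_upwards [Filter.eventually_all.2 fun j =>
    h.sum_mul Finset.univ (fun i => LinearMap.toMatrix' f j i) u] with t ht
  ext j
  have h1 : f u = (LinearMap.toMatrix' f).mulVec u := by rw [LinearMap.toMatrix'_mulVec]
  rw [Function.comp_apply, h1, Matrix.mulVec, dotProduct, ht]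
  simp only [spMap, Matrix.toLin'_apply, Matrix.mulVec, dotProduct]
  refine Finset.sum_congr rfl fun i _ => ?_
  rw [Matrix.map_apply, Function.comp_apply]

theorem linearIndependent (h : IsEventualHom l ev) {I T : Type} [Fintype I] [Fintype T]
    {s : T → I → Ω} (hs : LinearIndependent Ω s) :
    ∀ᶠ t in l, LinearIndependent k fun i => ev t ∘ s i := by
  classical
  obtain ⟨g, hg⟩ := (Fintype.linearCombination Ω s).exists_leftInverse_of_injective
    (LinearMap.ker_eq_bot.2 hs.fintypeLinearCombination_injective)
  have hgs : ∀ i, g (s i) = Pi.single i 1 := fun i => by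
    have := LinearMap.congr_fun hg (Pi.single i 1)
    simpa [Fintype.linearCombination_apply_single] using this
  filter_upwards [h.zero, h.one, Filter.eventually_all.2 fun i => h.spMap_apply g (s i)]
    with t h0 h1 h2
  refine LinearIndependent.of_comp (spMap (ev t) g) ?_
  convert (Pi.basisFun k T).linearIndependent using 1
  ext i j
  rw [Function.comp_apply, h2, hgs, Function.comp_apply, Pi.basisFun_apply]
  by_cases hij : j = i
  · subst hij; simpa using h1
  · simpa [Pi.single_apply, hij] using h0

theorem linearCombination (h : IsEventualHom l ev) {I T : Type} [Finite I] [Fintype T]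
    (s : T → I → Ω) (c : T → Ω) :
    ∀ᶠ t in l, ev t ∘ (∑ i, c i • s i) = ∑ i, ev t (c i) • (ev t ∘ s i) := by
  filter_upwards [Filter.eventually_all.2 fun j =>
    h.sum_mul Finset.univ c fun i => s i j] with t ht
  ext j
  simp only [Function.comp_apply, Finset.sum_apply, Pi.smul_apply, smul_eq_mul]
  exact ht j

theorem mem_span (h : IsEventualHom l ev) {I T : Type} [Finite I] [Fintype T]
    {s : T → I → Ω} {u : I → Ω} (hu : u ∈ span Ω (Set.range s)) :
    ∀ᶠ t in l, ev t ∘ u ∈ span k (Set.range fun i => ev t ∘ s i) := by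
  obtain ⟨c, rfl⟩ := (Submodule.mem_span_range_iff_exists_fun Ω).1 hu
  filter_upwards [h.linearCombination s c] with t ht
  rw [ht]
  exact sum_mem fun i _ => smul_mem _ _ (subset_span ⟨i, rfl⟩)

theorem span_finBasis {I : Type} [Fintype I] (S : Submodule Ω (I → Ω)) :
    span Ω (Set.range fun i => (finBasis Ω S i : I → Ω)) = S := by
  have h : (fun i => (finBasis Ω S i : I → Ω)) = S.subtype ∘ finBasis Ω S := rfl
  rw [h, Set.range_comp, ← Submodule.map_span, (finBasis Ω S).span_eq, Submodule.map_top,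
    Submodule.range_subtype]

theorem mem_spSub (h : IsEventualHom l ev) {I : Type} [Fintype I] {S : Submodule Ω (I → Ω)}
    {u : I → Ω} (hu : u ∈ S) : ∀ᶠ t in l, ev t ∘ u ∈ spSub (ev t) S := by
  refine h.mem_span ?_
  rwa [span_finBasis]

theorem finrank_spSub (h : IsEventualHom l ev) {I : Type} [Fintype I]
    (S : Submodule Ω (I → Ω)) :
    ∀ᶠ t in l, finrank k (spSub (ev t) S) = finrank Ω S := by
  have h1 : LinearIndependent Ω fun i => (finBasis Ω S i : I → Ω) :=
    (finBasis Ω S).linearIndependent.map' S.subtype S.ker_subtype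
  filter_upwards [h.linearIndependent h1] with t ht
  rw [spSub, finrank_span_eq_card ht, Fintype.card_fin]

theorem spSub_top (h : IsEventualHom l ev) {I : Type} [Fintype I] :
    ∀ᶠ t in l, spSub (ev t) (⊤ : Submodule Ω (I → Ω)) = ⊤ := by
  filter_upwards [h.finrank_spSub (⊤ : Submodule Ω (I → Ω))] with t ht
  refine Submodule.eq_top_of_finrank_eq ?_
  rw [ht, finrank_top, finrank_fintype_fun_eq_card, finrank_fintype_fun_eq_card]

theorem spSub_inf_ker (h : IsEventualHom l ev) {I J : Type} [Fintype I] [Fintype J]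
    (S : Submodule Ω (I → Ω)) (η : (I → Ω) →ₗ[Ω] (J → Ω)) :
    ∀ᶠ t in l, spSub (ev t) (S ⊓ LinearMap.ker η) =
      spSub (ev t) S ⊓ LinearMap.ker (spMap (ev t) η) := by
  set S' := S ⊓ LinearMap.ker η with hS'
  let b := finBasis Ω (S.map η)
  have hb : ∀ i, ∃ p ∈ S, η p = b i := fun i => (b i).2
  choose p hpS hp using hb
  have hli : LinearIndependent Ω fun i => η (p i) := by
    simp only [hp]
    exact b.linearIndependent.map' (S.map η).subtype (S.map η).ker_subtype
  let q : Fin (finrank Ω S') ⊕ Fin (finrank Ω (S.map η)) → I → Ω :=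
    Sum.elim (fun i => (finBasis Ω S' i : I → Ω)) p
  have hq : ∀ u ∈ S, u ∈ span Ω (Set.range q) := by
    intro u hu
    obtain ⟨c, hc⟩ := (Submodule.mem_span_range_iff_exists_fun Ω).1
      (b.mem_span ⟨η u, mem_map_of_mem hu⟩)
    have hc' : ∑ i, c i • η (p i) = η u := by
      have := congrArg (S.map η).subtype hc
      simpa [hp] using this
    have h1 : u - ∑ i, c i • p i ∈ S' := by
      refine ⟨sub_mem hu (sum_mem fun i _ => smul_mem _ _ (hpS i)), ?_⟩
      change η _ = 0
      simp [hc']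
    rw [← span_finBasis S'] at h1
    have h2 : u - ∑ i, c i • p i ∈ span Ω (Set.range q) := by
      refine span_mono ?_ h1
      rintro _ ⟨i, rfl⟩
      exact ⟨Sum.inl i, rfl⟩
    have h3 : ∑ i, c i • p i ∈ span Ω (Set.range q) :=
      sum_mem fun i _ => smul_mem _ _ (subset_span ⟨Sum.inr i, rfl⟩)
    simpa using add_mem h2 h3
  filter_upwards [h.zero, h.linearIndependent hli,
    Filter.eventually_all.2 fun i => h.spMap_apply η (p i),
    Filter.eventually_all.2 fun i => h.spMap_apply η (finBasis Ω S' i : I → Ω),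
    Filter.eventually_all.2 fun i => h.mem_spSub (finBasis Ω S' i).2.1,
    Filter.eventually_all.2 fun i => h.mem_span (hq _ (finBasis Ω S i).2)]
    with t h0 h1 h2 h3 h4 h5
  have hker : spSub (ev t) S' ≤ LinearMap.ker (spMap (ev t) η) := by
    refine span_le.2 ?_
    rintro _ ⟨i, rfl⟩
    have h6 : η (finBasis Ω S' i : I → Ω) = 0 := (finBasis Ω S' i).2.2
    change spMap (ev t) η _ = 0
    rw [h3, h6]
    ext j
    exact h0
  refine le_antisymm (le_inf ?_ hker) ?_
  · refine span_le.2 ?_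
    rintro _ ⟨i, rfl⟩
    exact h4 i
  · rintro z ⟨hz, hz'⟩
    have hz1 : z ∈ span k (Set.range fun i => ev t ∘ q i) := by
      refine span_le.2 ?_ hz
      rintro _ ⟨i, rfl⟩
      exact h5 i
    obtain ⟨c, rfl⟩ := (Submodule.mem_span_range_iff_exists_fun k).1 hz1
    rw [Fintype.sum_sum_type] at hz' ⊢
    have h6 : ∑ i, c (Sum.inl i) • (ev t ∘ q (Sum.inl i)) ∈ spSub (ev t) S' :=
      sum_mem fun i _ => smul_mem _ _ (subset_span ⟨i, rfl⟩)
    have h7 : ∑ i, c (Sum.inr i) • (ev t ∘ q (Sum.inr i)) ∈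
        LinearMap.ker (spMap (ev t) η) := by
      have := sub_mem hz' (hker h6)
      simpa using this
    rw [LinearMap.mem_ker, map_sum] at h7
    simp only [map_smul] at h7
    have h8 := Fintype.linearIndependent_iff.1 h1 (fun i => c (Sum.inr i)) (by
      rw [← h7]
      refine Finset.sum_congr rfl fun i _ => ?_
      rw [← h2]
      rfl)
    simp only [h8, zero_smul, Finset.sum_const_zero, add_zero]
    exact h6

theorem spMap_comp (h : IsEventualHom l ev) {I J L : Type} [Fintype I] [Fintype J] [Finite L]
    (f : (I → Ω) →ₗ[Ω] (J → Ω)) (g : (J → Ω) →ₗ[Ω] (L → Ω)) :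
    ∀ᶠ t in l, spMap (ev t) (g ∘ₗ f) = spMap (ev t) g ∘ₗ spMap (ev t) f := by
  classical
  have hbasis : ∀ᶠ t in l, ∀ i : I, ev t ∘ (Pi.single i 1 : I → Ω) = Pi.single i 1 := by
    filter_upwards [h.zero, h.one] with t h0 h1 i
    ext j
    by_cases hij : j = i
    · subst hij; simpa using h1
    · simpa [Pi.single_apply, hij] using h0
  filter_upwards [hbasis, Filter.eventually_all.2 fun i => h.spMap_apply f (Pi.single i 1),
    Filter.eventually_all.2 fun i => h.spMap_apply (g ∘ₗ f) (Pi.single i 1),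
    Filter.eventually_all.2 fun i => h.spMap_apply g (f (Pi.single i 1))] with t h0 h1 h2 h3
  refine (Pi.basisFun k I).ext fun i => ?_
  rw [Pi.basisFun_apply, ← h0, h2, LinearMap.comp_apply, LinearMap.comp_apply, h1, h3]

theorem spMap_sub (h : IsEventualHom l ev) {I J : Type} [Fintype I] [Finite J]
    (f g : (I → Ω) →ₗ[Ω] (J → Ω)) :
    ∀ᶠ t in l, spMap (ev t) (f - g) = spMap (ev t) f - spMap (ev t) g := by
  classical
  filter_upwards [Filter.eventually_all.2 fun i => Filter.eventually_all.2 fun j =>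
    h.sub (LinearMap.toMatrix' f j i) (LinearMap.toMatrix' g j i)] with t ht
  rw [spMap, spMap, spMap, ← map_sub]
  congr 1
  ext j i
  simp only [map_sub, Matrix.map_apply, Matrix.sub_apply]
  convert ht i j

section Reps

variable {ι κ : Type} {src tgt : κ → ι} [Finite ι] [Finite κ] {I J : ι → Type}
  [∀ v, Fintype (I v)] [∀ v, Fintype (J v)]
  {x : RepMaps Ω src tgt fun v => I v → Ω} {y : RepMaps Ω src tgt fun v => J v → Ω}

theorem isIterKer (h : IsEventualHom l ev) {S : ∀ v, Submodule Ω (I v → Ω)}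
    (hS : IsIterKer x y S) :
    ∀ᶠ t in l, IsIterKer (spRep (ev t) x) (spRep (ev t) y) fun v => spSub (ev t) (S v) := by
  induction hS with
  | top =>
    filter_upwards [Filter.eventually_all.2 fun v => h.spSub_top (I := I v)] with t ht
    simp only [ht]
    exact IsIterKer.top
  | @step S hS η hη ih =>
    filter_upwards [ih, Filter.eventually_all.2 fun v => h.spSub_inf_ker (S v) (η v),
      Filter.eventually_all.2 fun a => Filter.eventually_all.2 fun i =>
        h.spMap_apply (x a) (finBasis Ω (S (src a)) i),
      Filter.eventually_all.2 fun a => Filter.eventually_all.2 fun i =>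
        h.spMap_apply (η (tgt a)) (x a (finBasis Ω (S (src a)) i)),
      Filter.eventually_all.2 fun a => Filter.eventually_all.2 fun i =>
        h.spMap_apply (η (src a)) (finBasis Ω (S (src a)) i),
      Filter.eventually_all.2 fun a => Filter.eventually_all.2 fun i =>
        h.spMap_apply (y a) (η (src a) (finBasis Ω (S (src a)) i))] with t h1 h2 h3 h4 h5 h6
    simp only [h2]
    refine h1.step _ fun a m hm => ?_
    have h7 : spSub (ev t) (S (src a)) ≤
        LinearMap.eqLocus (spMap (ev t) (η (tgt a)) ∘ₗ spRep (ev t) x a)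
          (spRep (ev t) y a ∘ₗ spMap (ev t) (η (src a))) := by
      refine span_le.2 ?_
      rintro _ ⟨i, rfl⟩
      change spMap (ev t) (η (tgt a)) (spMap (ev t) (x a) _) =
        spMap (ev t) (y a) (spMap (ev t) (η (src a)) _)
      rw [h3, h4, h5, h6, hη _ _ (finBasis Ω (S (src a)) i).2]
    exact h7 hm

end Reps

section ExtDim

variable {ι κ : Type} {src tgt : κ → ι} [Fintype κ] {I J : ι → Type}
  [∀ v, Fintype (I v)] [∀ v, Fintype (J v)]
  (x : RepMaps Ω src tgt fun v => I v → Ω) (y : RepMaps Ω src tgt fun v => J v → Ω)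

theorem linearIndependent_spMap (h : IsEventualHom l ev) {T : Type} [Fintype T]
    {w : T → ∀ a, (I (src a) → Ω) →ₗ[Ω] (J (tgt a) → Ω)} (hw : LinearIndependent Ω w) :
    ∀ᶠ t in l, LinearIndependent k fun i a => spMap (ev t) (w i a) := by
  classical
  let co (K : Type) [Field K] : (∀ a, (I (src a) → K) →ₗ[K] (J (tgt a) → K)) →ₗ[K]
      ((Σ a, J (tgt a) × I (src a)) → K) :=
    { toFun := fun w p => LinearMap.toMatrix' (w p.1) p.2.1 p.2.2
      map_add' := fun _ _ => by ext; simp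
      map_smul' := fun _ _ => by ext; simp }
  have hco : Function.Injective (co Ω) := by
    intro f g hfg
    ext1 a
    refine LinearMap.toMatrix'.injective ?_
    ext j i
    exact congrFun hfg ⟨a, j, i⟩
  filter_upwards [h.linearIndependent (hw.map' (co Ω) (LinearMap.ker_eq_bot.2 hco))] with t ht
  refine LinearIndependent.of_comp (co k) ?_
  convert ht using 1
  ext i p
  change LinearMap.toMatrix' (spMap (ev t) (w i p.1)) p.2.1 p.2.2 =
    ev t (LinearMap.toMatrix' (w i p.1) p.2.1 p.2.2)
  rw [spMap]
  have := LinearMap.toMatrix'_toLin' ((LinearMap.toMatrix' (w i p.1)).map (ev t))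
  have := congrFun (congrFun this p.2.1) p.2.2
  rw [Matrix.map_apply] at this
  convert this

theorem extDim_le [Fintype ι] (h : IsEventualHom l ev) :
    ∀ᶠ t in l, extDim (spRep (ev t) x) (spRep (ev t) y) ≤ extDim x y := by
  let b := finBasis Ω (LinearMap.range (repDiff x y))
  choose φ hφ using fun i => (b i).2
  have hli : LinearIndependent Ω fun i => repDiff x y (φ i) := by
    simp only [hφ]
    exact b.linearIndependent.map' (LinearMap.range (repDiff x y)).subtype (ker_subtype _)
  filter_upwards [h.linearIndependent_spMap hli,
    Filter.eventually_all.2 fun i => Filter.eventually_all.2 fun a =>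
      h.spMap_sub (φ i (tgt a) ∘ₗ x a) (y a ∘ₗ φ i (src a)),
    Filter.eventually_all.2 fun i => Filter.eventually_all.2 fun a =>
      h.spMap_comp (x a) (φ i (tgt a)),
    Filter.eventually_all.2 fun i => Filter.eventually_all.2 fun a =>
      h.spMap_comp (φ i (src a)) (y a)] with t h1 h2 h3 h4
  have h5 : ∀ i, (fun a => spMap (ev t) (repDiff x y (φ i) a)) =
      repDiff (spRep (ev t) x) (spRep (ev t) y) (fun v => spMap (ev t) (φ i v)) := by
    intro i
    ext1 a
    have : repDiff x y (φ i) a = φ i (tgt a) ∘ₗ x a - y a ∘ₗ φ i (src a) := rfl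
    rw [this, h2, h3, h4]
    rfl
  rw [funext h5] at h1
  have h6 : finrank Ω (LinearMap.range (repDiff x y)) ≤
      finrank k (LinearMap.range (repDiff (spRep (ev t) x) (spRep (ev t) y))) := by
    have h7 : LinearIndependent k fun i =>
        (⟨_, ⟨(fun v => spMap (ev t) (φ i v)), rfl⟩⟩ :
          LinearMap.range (repDiff (spRep (ev t) x) (spRep (ev t) y))) :=
      LinearIndependent.of_comp (Submodule.subtype _) h1
    simpa using h7.fintype_card_le_finrank
  rw [extDim_eq, extDim_eq]
  simp only [Module.finrank_pi_fintype, Module.finrank_linearMap, finrank_self]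
  omega

end ExtDim

end IsEventualHom

end Specialization

section Ultraproduct

/-- The representation with prescribed matrices. -/
def matRep {K : Type} [Field K] {ι κ : Type} {src tgt : κ → ι} {I : ι → Type} [∀ v, Fintype (I v)]
    (c : (Σ a, I (tgt a) × I (src a)) → K) : RepMaps K src tgt fun v => I v → K :=
  fun a => (Matrix.of fun i j => c ⟨a, i, j⟩).mulVecLin

theorem spRep_matRep {Ω k : Type} [Field Ω] [Field k] (g : Ω → k) {ι κ : Type} {src tgt : κ → ι}
    {I : ι → Type} [∀ v, Fintype (I v)] (c : (Σ a, I (tgt a) × I (src a)) → Ω) :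
    spRep g (matRep c) = matRep (g ∘ c) := by
  funext a
  let _ := Classical.decEq (I (src a))
  change Matrix.toLin' ((LinearMap.toMatrix'
    (Matrix.toLin' (Matrix.of fun i j => c ⟨a, i, j⟩))).map g) = _
  rw [LinearMap.toMatrix'_toLin']
  rfl

theorem repEntries_matRep {K : Type} [Field K] {ι κ : Type} {src tgt : κ → ι} {I : ι → Type}
    [∀ v, Fintype (I v)] (c : (Σ a, I (tgt a) × I (src a)) → K) :
    repEntries (fun v => Pi.basisFun K (I v)) (matRep c) = c := by
  classical
  ext p
  simp [repEntries, matRep]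

theorem exists_ultraproduct {X k : Type} [Field k] (l : Ultrafilter X) :
    ∃ (Ω : Type) (_ : Field Ω) (φ : (X → k) →+* Ω), Function.Surjective φ ∧
      ∀ f g, φ f = φ g ↔ ∀ᶠ t in (l : Filter X), f t = g t :=
  ⟨Filter.Germ (l : Filter X) k, inferInstance, Filter.Germ.coeRingHom (l : Filter X),
    Quotient.mk_surjective, fun _ _ => Filter.Germ.coe_eq⟩

variable {k : Type} [Field k] {ι κ : Type} [Fintype ι] [Fintype κ] (src tgt : κ → ι)
  {I J : ι → Type} [∀ v, Fintype (I v)] [∀ v, Fintype (J v)]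

/-- The extension group of the pair is computed by an iterated kernel. -/
def HasIterKer {K : Type} [Field K] {V W : ι → Type} [∀ v, AddCommGroup (V v)]
    [∀ v, Module K (V v)] [∀ v, AddCommGroup (W v)] [∀ v, Module K (W v)] {src tgt : κ → ι}
    (x : RepMaps K src tgt V) (y : RepMaps K src tgt W) : Prop :=
  ∃ T : ∀ v, Submodule K (V v), IsIterKer x y T ∧
    eulerForm src tgt (dimVec K fun v => ↥(T v)) (dimVec K V - dimVec K fun v => ↥(T v)) = 0 ∧
    extDim x y = -eulerForm src tgt (dimVec K fun v => ↥(T v)) (dimVec K W)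

theorem IsEventualHom.hasIterKer {X Ω : Type} [Field Ω] {l : Filter X} {ev : X → Ω → k}
    (h : IsEventualHom l ev) {src tgt : κ → ι} {x : RepMaps Ω src tgt fun v => I v → Ω}
    {y : RepMaps Ω src tgt fun v => J v → Ω} (hxy : HasIterKer x y) :
    ∀ᶠ t in l, HasIterKer (spRep (ev t) x) (spRep (ev t) y) := by
  obtain ⟨T, hT, hT0, hext⟩ := hxy
  filter_upwards [h.isIterKer hT, h.extDim_le x y,
    Filter.eventually_all.2 fun v => h.finrank_spSub (T v)] with t h1 h2 h3
  have hd : (dimVec k fun v => ↥(spSub (ev t) (T v))) = dimVec Ω fun v => ↥(T v) := by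
    ext v
    simp [dimVec, h3]
  have hdI : (dimVec k fun v => I v → k) = dimVec Ω fun v => I v → Ω := by
    ext v
    simp [dimVec]
  have hdJ : (dimVec k fun v => J v → k) = dimVec Ω fun v => J v → Ω := by
    ext v
    simp [dimVec]
  refine ⟨_, h1, ?_, le_antisymm ?_ ?_⟩
  · rw [hd, hdI, hT0]
  · rw [hd, hdJ, ← hext]
    exact h2
  · exact neg_eulerForm_le_extDim _ _ (subRep _ h1.isSubrep) (spRep (ev t) y) _
      (fun v => Subtype.val_injective) (subtype_mem_repHom _)
      (fun v => LinearMap.id) (fun v => Function.surjective_id)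
      (mem_repHom.2 fun _ _ => rfl)

theorem exists_hasIterKer_of_eval_ne_zero_aux :
    ∃ f : MvPolynomial (((Σ a, I (tgt a) × I (src a)) ⊕ (Σ a, J (tgt a) × J (src a))) ⊕ ℕ) k,
      f ≠ 0 ∧ ∀ t, MvPolynomial.eval t f ≠ 0 →
        HasIterKer (src := src) (tgt := tgt) (matRep (I := I) fun p => t (Sum.inl (Sum.inl p)))
          (matRep (I := J) fun p => t (Sum.inl (Sum.inr p))) := by
  by_contra! hbad
  set E := ((Σ a, I (tgt a) × I (src a)) ⊕ (Σ a, J (tgt a) × J (src a))) ⊕ ℕ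
  let B : {f : MvPolynomial E k // f ≠ 0} → Set (E → k) := fun f =>
    {t | MvPolynomial.eval t f.1 ≠ 0 ∧
      ¬HasIterKer (src := src) (tgt := tgt) (matRep (I := I) fun p => t (Sum.inl (Sum.inl p)))
          (matRep (I := J) fun p => t (Sum.inl (Sum.inr p)))}
  have hne : (⨅ f, Filter.principal (B f)).NeBot := by
    have : Nonempty {f : MvPolynomial E k // f ≠ 0} := ⟨1, one_ne_zero⟩
    refine Filter.iInf_neBot_of_directed' ?_ ?_
    · rintro ⟨f, hf⟩ ⟨g, hg⟩
      refine ⟨⟨f * g, mul_ne_zero hf hg⟩, ?_, ?_⟩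
      · refine Filter.principal_mono.2 ?_
        rintro t ⟨h1, h2⟩
        rw [map_mul] at h1
        exact ⟨left_ne_zero_of_mul h1, h2⟩
      · refine Filter.principal_mono.2 ?_
        rintro t ⟨h1, h2⟩
        rw [map_mul] at h1
        exact ⟨right_ne_zero_of_mul h1, h2⟩
    · rintro ⟨f, hf⟩
      rw [Filter.principal_neBot_iff]
      obtain ⟨t, ht⟩ := hbad f hf
      exact ⟨t, ht⟩
  let l : Ultrafilter (E → k) := Ultrafilter.of (⨅ f, Filter.principal (B f))
  have hl : ∀ f, B f ∈ (l : Filter (E → k)) := fun f =>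
    Ultrafilter.of_le _ (Filter.mem_iInf_of_mem f (Filter.mem_principal_self _))
  obtain ⟨Ω, _, φ, hφs, hφ⟩ := exists_ultraproduct (k := k) l
  let _ : Algebra k Ω := (φ.comp (Pi.constRingHom (E → k) k)).toAlgebra
  let ev : (E → k) → Ω → k := fun t z => Function.surjInv hφs z t
  have hev : ∀ z, φ (fun t => ev t z) = z := fun z => Function.surjInv_eq hφs z
  have hevφ : ∀ g, ∀ᶠ t in l, ev t (φ g) = g t := fun g => (hφ _ _).1 (hev (φ g))
  have hhom : IsEventualHom (l : Filter (E → k)) ev := by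
    refine ⟨?_, fun a b => ?_, fun a b => ?_⟩
    · refine (hφ _ (fun _ => 1)).1 ?_
      rw [hev]
      exact (map_one φ).symm
    · refine (hφ _ ((fun t => ev t a) + fun t => ev t b)).1 ?_
      rw [map_add, hev, hev, hev]
    · refine (hφ _ ((fun t => ev t a) * fun t => ev t b)).1 ?_
      rw [map_mul, hev, hev, hev]
  let z : E → Ω := fun e => φ fun t => t e
  have haeval : ∀ f : MvPolynomial E k,
      MvPolynomial.aeval z f = φ fun t => MvPolynomial.eval t f := by
    intro f
    induction f using MvPolynomial.induction_on with
    | C a =>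
      simp only [MvPolynomial.algHom_C, MvPolynomial.eval_C]
      rfl
    | add f g hf hg =>
      rw [map_add, hf, hg, ← map_add]
      congr 1
      ext t
      simp
    | mul_X f e hf =>
      rw [map_mul, hf, MvPolynomial.aeval_X, ← map_mul]
      congr 1
      ext t
      simp
  have hz : AlgebraicIndependent k z := by
    rw [algebraicIndependent_iff]
    intro f hf
    by_contra hf0
    rw [haeval, ← map_zero φ, hφ] at hf
    obtain ⟨t, h1, h2⟩ := (hf.and (Filter.eventually_mem_set.2 (hl ⟨f, hf0⟩))).exists
    exact h2.1 h1
  have htr : Cardinal.aleph0 ≤ Algebra.trdeg k Ω := by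
    have := (hz.comp (Sum.inr : ℕ → E) Sum.inr_injective).cardinalMk_le_trdeg
    simpa using this
  have hgp : GenericPair k (src := src) (tgt := tgt) 
      (matRep (I := I) fun p => z (Sum.inl (Sum.inl p)))
      (matRep (I := J) fun p => z (Sum.inl (Sum.inr p))) := by
    refine ⟨I, J, inferInstance, inferInstance, fun v => Pi.basisFun Ω (I v),
      fun v => Pi.basisFun Ω (J v), ?_⟩
    rw [repEntries_matRep, repEntries_matRep]
    convert hz.comp Sum.inl Sum.inl_injective using 1
    ext (p | p) <;> rfl
  have hmain := hhom.hasIterKer (hgp.exists_isIterKer htr _ (Nat.lt_succ_self _))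
  have hcoord : ∀ e, ∀ᶠ t in l, ev t (z e) = t e := fun e => hevφ _
  obtain ⟨t, h1, h2, h3, h4⟩ := (hmain.and ((Filter.eventually_mem_set.2 (hl ⟨1, one_ne_zero⟩)).and
    ((Filter.eventually_all.2 fun e : Σ a, I (tgt a) × I (src a) =>
      hcoord (Sum.inl (Sum.inl e))).and
    (Filter.eventually_all.2 fun e : Σ a, J (tgt a) × J (src a) =>
      hcoord (Sum.inl (Sum.inr e)))))).exists
  refine h2.2 ?_
  rw [spRep_matRep, spRep_matRep] at h1
  convert h1 using 2
  · ext p; exact (h3 p).symm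
  · ext p; exact (h4 p).symm

theorem exists_hasIterKer_of_eval_ne_zero [Infinite k] :
    ∃ f : MvPolynomial ((Σ a, I (tgt a) × I (src a)) ⊕ (Σ a, J (tgt a) × J (src a))) k,
      f ≠ 0 ∧ ∀ t, MvPolynomial.eval t f ≠ 0 →
        HasIterKer (src := src) (tgt := tgt) (matRep (I := I) (t ∘ Sum.inl))
          (matRep (I := J) (t ∘ Sum.inr)) := by
  obtain ⟨f, hf, h⟩ := exists_hasIterKer_of_eval_ne_zero_aux (k := k) src tgt (I := I) (J := J)
  obtain ⟨t₀, ht₀⟩ : ∃ t, MvPolynomial.eval t f ≠ 0 := by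
    by_contra! h0
    exact hf (MvPolynomial.funext fun t => by rw [h0, map_zero])
  let g : _ → MvPolynomial ((Σ a, I (tgt a) × I (src a)) ⊕ (Σ a, J (tgt a) × J (src a))) k :=
    Sum.elim MvPolynomial.X fun i : ℕ => MvPolynomial.C (t₀ (Sum.inr i))
  have hev : ∀ t, MvPolynomial.eval t (MvPolynomial.aeval g f) =
      MvPolynomial.eval (Sum.elim t fun i => t₀ (Sum.inr i)) f := by
    intro t
    have h1 : (MvPolynomial.aeval t).comp (MvPolynomial.aeval g) =
        MvPolynomial.aeval (R := k) (Sum.elim t fun i => t₀ (Sum.inr i)) := by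
      ext (e | e) <;> simp [g]
    exact DFunLike.congr_fun h1 f
  refine ⟨MvPolynomial.aeval g f, fun h0 => ht₀ ?_, fun t ht => ?_⟩
  · have h1 := hev (t₀ ∘ Sum.inl)
    rw [h0, map_zero] at h1
    rw [h1]
    congr 2
    ext (e | e) <;> rfl
  · rw [hev] at ht
    exact h _ ht

end Ultraproduct

section FlagQuiver

variable {s r : ℕ}

/-- The target of the `u`-th arrow of the star-shaped quiver with `s` arms of length `r`, whose
arrows point towards the centre `none`. -/
def flagTgt (u : Fin s × Fin r) : Option (Fin s × Fin r) :=
  if h : (u.2 : ℕ) + 1 < r then some (u.1, ⟨u.2 + 1, h⟩) else none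

theorem flagTgt_cases (u : Fin s × Fin r) :
    flagTgt u = none ∨ ∃ a : Fin r, (a : ℕ) = u.2 + 1 ∧ flagTgt u = some (u.1, a) := by
  by_cases h : (u.2 : ℕ) + 1 < r
  · exact Or.inr ⟨⟨u.2 + 1, h⟩, rfl, dif_pos h⟩
  · exact Or.inl (dif_neg h)

/-- The distance of a vertex to the centre. -/
def flagDepth : Option (Fin s × Fin r) → ℕ
  | none => 0
  | some u => r - u.2

theorem flagDepth_flagTgt_lt (u : Fin s × Fin r) : flagDepth (flagTgt u) < flagDepth (some u) := by
  have := u.2.2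
  obtain h | ⟨a, ha, h⟩ := flagTgt_cases u <;> rw [h] <;> simp only [flagDepth] <;> omega

theorem flagTgt_induction {P : Option (Fin s × Fin r) → Prop} (h0 : P none)
    (h : ∀ u, P (flagTgt u) → P (some u)) : ∀ v, P v
  | none => h0
  | some u => h u (flagTgt_induction h0 h (flagTgt u))
termination_by v => flagDepth v
decreasing_by exact flagDepth_flagTgt_lt u

/-- The composition of the arrows from a vertex to the centre. -/
def toCentre {K : Type} [Field K] {M : Option (Fin s × Fin r) → Type} [∀ v, AddCommGroup (M v)]
    [∀ v, Module K (M v)] (x : RepMaps K some flagTgt M) : ∀ v, M v →ₗ[K] M none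
  | none => LinearMap.id
  | some u => toCentre x (flagTgt u) ∘ₗ x u
termination_by v => flagDepth v
decreasing_by exact flagDepth_flagTgt_lt u

section

variable {K : Type} [Field K] {M : Option (Fin s × Fin r) → Type} [∀ v, AddCommGroup (M v)]
    [∀ v, Module K (M v)] (x : RepMaps K some flagTgt M)

theorem toCentre_none : toCentre x none = LinearMap.id := by
  rw [toCentre]

theorem toCentre_some (u : Fin s × Fin r) :
    toCentre x (some u) = toCentre x (flagTgt u) ∘ₗ x u := by
  rw [toCentre]

theorem toCentre_injective (hx : ∀ u, Function.Injective (x u)) :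
    ∀ v, Function.Injective (toCentre x v) := by
  refine flagTgt_induction ?_ fun u hu => ?_
  · rw [toCentre_none]
    exact Function.injective_id
  · rw [toCentre_some]
    exact hu.comp (hx u)

theorem range_toCentre_mono (j : Fin s) :
    Monotone fun a : Fin r => LinearMap.range (toCentre x (some (j, a))) := by
  have key : ∀ m (a b : Fin r), (b : ℕ) = a + m →
      LinearMap.range (toCentre x (some (j, a))) ≤ LinearMap.range (toCentre x (some (j, b))) := by
    intro m
    induction m with
    | zero =>
      intro a b hab
      obtain rfl : b = a := Fin.ext hab
      exact le_rfl
    | succ m ih =>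
      intro a b hab
      obtain h | ⟨a', ha', h⟩ := flagTgt_cases (j, a)
      · have := b.2
        rw [flagTgt, dif_pos (show (a : ℕ) + 1 < r by omega)] at h
        cases h
      · refine le_trans ?_ (ih a' b (by simp only at ha'; omega))
        have h1 : LinearMap.range (toCentre x (some (j, a))) ≤
            LinearMap.range (toCentre x (flagTgt (j, a))) := by
          rw [toCentre_some]
          exact LinearMap.range_comp_le_range _ _
        rwa [h] at h1
  intro a b hab
  exact key (b - a) a b (by have : (a : ℕ) ≤ b := hab; omega)

end

end FlagQuiver

section AdaptedToChain

theorem spanFlag_eq_span {K V : Type} [Field K] [AddCommGroup V] [Module K V] {p : ℕ}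
    (w : ℕ → V) {m : ℕ} (hm : m ≤ p) :
    spanFlag K (fun l : Fin p => w l) m = span K (w '' {l | l < m}) := by
  rw [spanFlag]
  congr 1
  ext z
  constructor
  · rintro ⟨l, hl, rfl⟩
    exact ⟨l, hl, rfl⟩
  · rintro ⟨l, hl, rfl⟩
    exact ⟨⟨l, lt_of_lt_of_le hl hm⟩, hl, rfl⟩

variable {K V : Type} [Field K] [AddCommGroup V] [Module K V] [FiniteDimensional K V]

theorem exists_extend_span {A W : Submodule K V} (hAW : A ≤ W) (w : ℕ → V)
    (hw : span K (w '' {l | l < finrank K A}) = A) :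
    ∃ w' : ℕ → V, (∀ l < finrank K A, w' l = w l) ∧
      span K (w' '' {l | l < finrank K W}) = W := by
  obtain ⟨C, hC⟩ := Submodule.exists_isCompl (comap W.subtype A)
  set D := C.map W.subtype with hD
  have hsup : A ⊔ D = W := by
    have h1 := congrArg (Submodule.map W.subtype) hC.sup_eq_top
    rwa [Submodule.map_sup, Submodule.map_comap_subtype, Submodule.map_top,
      Submodule.range_subtype, inf_eq_right.2 hAW] at h1
  have hinf : A ⊓ D = ⊥ := by
    have h1 := congrArg (Submodule.map W.subtype) hC.inf_eq_bot
    rwa [Submodule.map_inf _ W.injective_subtype, Submodule.map_comap_subtype, Submodule.map_bot,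
      inf_eq_right.2 hAW] at h1
  have hdim : finrank K W = finrank K A + finrank K D := by
    have h1 := Submodule.finrank_sup_add_finrank_inf_eq A D
    rw [hsup, hinf, finrank_bot] at h1
    omega
  let c : ℕ → V := fun l => if h : l < finrank K D then finBasis K D ⟨l, h⟩ else 0
  have hc : span K (c '' {l | l < finrank K D}) = D := by
    have h1 : c '' {l | l < finrank K D} = D.subtype '' Set.range (finBasis K D) := by
      ext z
      constructor
      · rintro ⟨l, hl, rfl⟩
        have hl : l < finrank K D := hl
        refine ⟨_, ⟨⟨l, hl⟩, rfl⟩, ?_⟩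
        simp only [c, dif_pos hl, Submodule.subtype_apply]
      · rintro ⟨_, ⟨l, rfl⟩, rfl⟩
        exact ⟨l, l.2, dif_pos l.2⟩
    rw [h1, ← Submodule.map_span, (finBasis K D).span_eq, Submodule.map_top,
      Submodule.range_subtype]
  refine ⟨fun l => if l < finrank K A then w l else c (l - finrank K A),
    fun l hl => if_pos hl, ?_⟩
  rw [← hsup]
  conv_rhs => rw [← hw, ← hc]
  rw [← Submodule.span_union]
  congr 1
  ext z
  rw [hsup, hdim]
  constructor
  · rintro ⟨l, hl, rfl⟩
    have hl : l < finrank K A + finrank K D := hl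
    by_cases h : l < finrank K A
    · exact Or.inl ⟨l, h, (if_pos h).symm⟩
    · exact Or.inr ⟨l - finrank K A, by rw [Set.mem_ofPred_eq]; omega, (if_neg h).symm⟩
  · rintro (⟨l, hl, rfl⟩ | ⟨l, hl, rfl⟩)
    · have hl : l < finrank K A := hl
      exact ⟨l, by rw [Set.mem_ofPred_eq]; omega, if_pos hl⟩
    · have hl : l < finrank K D := hl
      refine ⟨finrank K A + l, by rw [Set.mem_ofPred_eq]; omega, ?_⟩
      simp

theorem exists_span_eq_of_monotone {E : ℕ → Submodule K V} (hE : Monotone E) (m : ℕ) :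
    ∃ w : ℕ → V, ∀ i ≤ m, span K (w '' {l | l < finrank K (E i)}) = E i := by
  induction m with
  | zero =>
    obtain ⟨w, -, hw⟩ := exists_extend_span (A := (⊥ : Submodule K V)) (W := E 0) bot_le 0
      (by simp)
    refine ⟨w, fun i hi => ?_⟩
    obtain rfl : i = 0 := by omega
    exact hw
  | succ m ih =>
    obtain ⟨w, hw⟩ := ih
    obtain ⟨w', hw', hspan⟩ := exists_extend_span (hE m.le_succ) w (hw m le_rfl)
    refine ⟨w', fun i hi => ?_⟩
    obtain hi | rfl := Nat.le_or_eq_of_le_succ hi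
    · conv_rhs => rw [← hw i hi]
      congr 1
      refine Set.image_congr fun l hl => hw' l ?_
      exact lt_of_lt_of_le hl (Submodule.finrank_mono (hE hi))
    · exact hspan

/-- An increasing chain of subspaces consists of members of the flag spanned by some basis. -/
theorem exists_basis_spanFlag {r p : ℕ} (hp : finrank K V = p) {E : Fin r → Submodule K V}
    (hE : Monotone E) :
    ∃ b : Basis (Fin p) K V, ∀ a, spanFlag K b (finrank K (E a)) = E a := by
  let E' : ℕ → Submodule K V := fun i => if h : i < r then E ⟨i, h⟩ else ⊤
  have hE' : Monotone E' := by
    intro i i' hii'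
    by_cases h : i' < r
    · simp only [E']
      rw [dif_pos h, dif_pos (lt_of_le_of_lt hii' h)]
      exact hE hii'
    · simp only [E', dif_neg h, le_top]
  obtain ⟨w, hw⟩ := exists_span_eq_of_monotone hE' r
  have htop : ⊤ ≤ span K (Set.range fun l : Fin p => w l) := by
    have h1 := hw r le_rfl
    have h2 : E' r = ⊤ := dif_neg (lt_irrefl r)
    rw [h2, finrank_top, hp] at h1
    rw [← h1]
    refine span_mono ?_
    rintro _ ⟨l, hl, rfl⟩
    exact ⟨⟨l, hl⟩, rfl⟩
  refine ⟨basisOfTopLeSpanOfCardEqFinrank _ htop (by rw [hp, Fintype.card_fin]), fun a => ?_⟩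
  have h1 := hw a a.2.le
  have h2 : E' a = E a := dif_pos a.2
  rw [h2] at h1
  rw [coe_basisOfTopLeSpanOfCardEqFinrank, spanFlag_eq_span _ (hp ▸ Submodule.finrank_le _), h1]

end AdaptedToChain

section PolynomialFunctions

variable {K M M' : Type} [Field K] [AddCommGroup M] [Module K M] [AddCommGroup M'] [Module K M']

/-- Polynomial functions on a vector space. -/
def IsPolyFun (K : Type) {M : Type} [Field K] [AddCommGroup M] [Module K M] (φ : M → K) : Prop :=
  ∃ P : MvPolynomial (Dual K M) K, ∀ x, φ x = mEval K x P

theorem IsPolyFun.const (c : K) : IsPolyFun K fun _ : M => c :=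
  ⟨MvPolynomial.C c, fun x => by simp [mEval]⟩

theorem IsPolyFun.dual (f : Dual K M) : IsPolyFun K fun x => f x :=
  ⟨MvPolynomial.X f, fun x => by simp [mEval]⟩

theorem IsPolyFun.eval {E : Type} {φ : M → E → K} (hφ : ∀ e, IsPolyFun K fun x => φ x e)
    (f : MvPolynomial E K) : IsPolyFun K fun x => MvPolynomial.eval (φ x) f := by
  choose P hP using hφ
  refine ⟨MvPolynomial.aeval P f, fun x => ?_⟩
  have h1 : (MvPolynomial.aeval fun l : Dual K M => l x).comp (MvPolynomial.aeval P) =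
      MvPolynomial.aeval (R := K) (φ x) := by
    ext e
    simp only [AlgHom.comp_apply, MvPolynomial.aeval_X, hP e x]
    rfl
  exact (DFunLike.congr_fun h1 f).symm

theorem IsPolyFun.comp {φ : M' → K} (hφ : IsPolyFun K φ) (T : M →ₗ[K] M') :
    IsPolyFun K fun x => φ (T x) := by
  obtain ⟨P, hP⟩ := hφ
  refine ⟨MvPolynomial.rename (fun l => l ∘ₗ T) P, fun x => ?_⟩
  change φ (T x) = _
  rw [hP, mEval, mEval, MvPolynomial.eval_rename]
  rfl

theorem IsPolyFun.isOpen_ne_zero {φ : M → K} (hφ : IsPolyFun K φ) :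
    @IsOpen _ (mZariski K M) {x | φ x ≠ 0} := by
  obtain ⟨P, hP⟩ := hφ
  refine TopologicalSpace.isOpen_generateFrom_of_mem ⟨P, ?_⟩
  simp only [hP]

end PolynomialFunctions

section FlagFamily

variable {K V : Type} [Field K] [AddCommGroup V] [Module K V] [FiniteDimensional K V]
  {s r p : ℕ}

/-- The dimension vector of a representation of the star-shaped quiver. -/
def armDim (p : ℕ) (δ : Fin s → Fin r → ℕ) : Option (Fin s × Fin r) → ℕ
  | none => p
  | some u => δ u.1 u.2

/-- The realisation of a representation `X` of the star-shaped quiver by the members of flags. -/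
structure IsFlagRealisation {δ : Fin s → Fin r → ℕ}
    (X : RepMaps K some flagTgt fun v => Fin (armDim p δ v) → K) (F : Fin s → ℕ → Submodule K V)
    (θ : ∀ v, (Fin (armDim p δ v) → K) →ₗ[K] V) : Prop where
  injective : ∀ v, Function.Injective (θ v)
  surjective : Function.Surjective (θ none)
  map_arrow : ∀ u m, θ (flagTgt u) (X u m) = θ (some u) m
  range_eq : ∀ u, LinearMap.range (θ (some u)) = F u.1 (δ u.1 u.2)

/-- An endomorphism of the central space, extended by the identity to the other vertices. -/
def centreTwist (δ : Fin s → Fin r → ℕ)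
    (f : (Fin (armDim p δ none) → K) →ₗ[K] (Fin (armDim p δ none) → K)) :
    ∀ v, (Fin (armDim p δ v) → K) →ₗ[K] (Fin (armDim p δ v) → K)
  | none => f
  | some _ => LinearMap.id

theorem centreTwist_id (δ : Fin s → Fin r → ℕ) (v : Option (Fin s × Fin r)) :
    centreTwist δ (LinearMap.id : (Fin (armDim p δ none) → K) →ₗ[K] _) v = LinearMap.id := by
  cases v <;> rfl

theorem isPolyFun_centreTwist {M : Type} [AddCommGroup M] [Module K M] (δ : Fin s → Fin r → ℕ)
    {f : M → (Fin (armDim p δ none) → K) →ₗ[K] (Fin (armDim p δ none) → K)}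
    (hf : ∀ z i, IsPolyFun K fun b => f b z i) :
    ∀ v z i, IsPolyFun K fun b => centreTwist δ (f b) v z i
  | none => hf
  | some _ => fun z i => IsPolyFun.const (z i)

theorem exists_flagFamily (hp : finrank K V = p) {δ : Fin s → Fin r → ℕ}
    {x : RepMaps K some flagTgt fun v => Fin (armDim p δ v) → K}
    (hx : ∀ u, Function.Injective (x u)) :
    ∃ (X : (Fin s → Fin p → V) → RepMaps K some flagTgt fun v => Fin (armDim p δ v) → K)
      (b₀ : Fin s → Fin p → V), (∀ j, LinearIndependent K (b₀ j)) ∧ X b₀ = x ∧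
      (∀ u m i, IsPolyFun K fun b => X b u m i) ∧
      ∀ b, (∀ j, LinearIndependent K (b j)) →
        ∃ θ, IsFlagRealisation (X b) (fun j => spanFlag K (b j)) θ := by
  let e : (Fin (armDim p δ none) → K) ≃ₗ[K] V :=
    LinearEquiv.ofFinrankEq _ _ (by rw [hp, finrank_fintype_fun_eq_card, Fintype.card_fin]; rfl)
  let E : Fin s → Fin r → Submodule K V := fun j a =>
    (LinearMap.range (toCentre x (some (j, a)))).map e.toLinearMap
  have hE : ∀ j, Monotone (E j) := fun j a b hab =>
    Submodule.map_mono (range_toCentre_mono x j hab)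
  have hEδ : ∀ j a, finrank K (E j a) = δ j a := fun j a => by
    change finrank K ((LinearMap.range (toCentre x (some (j, a)))).map e.toLinearMap) = _
    rw [LinearEquiv.finrank_map_eq,
      LinearMap.finrank_range_of_inj (toCentre_injective x hx (some (j, a))),
      finrank_fintype_fun_eq_card, Fintype.card_fin]
    rfl
  choose B hB using fun j => exists_basis_spanFlag hp (hE j)
  let L : (Fin s → Fin p → V) → Fin s → V →ₗ[K] V := fun b j => (B j).constr K (b j)
  let Λ : (Fin s → Fin p → V) → Fin s →
      (Fin (armDim p δ none) → K) →ₗ[K] (Fin (armDim p δ none) → K) := fun b j =>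
    e.symm.toLinearMap ∘ₗ L b j ∘ₗ e.toLinearMap
  refine ⟨fun b u => centreTwist δ (Λ b u.1) (flagTgt u) ∘ₗ x u, fun j => B j,
    fun j => (B j).linearIndependent, ?_, ?_, ?_⟩
  · have h1 : ∀ j, Λ (fun j => B j) j = LinearMap.id := fun j => by
      have : L (fun j => B j) j = LinearMap.id := (B j).constr_self K LinearMap.id
      refine LinearMap.ext fun z => ?_
      change e.symm (L (fun j => B j) j (e z)) = z
      rw [this]
      exact e.symm_apply_apply z
    funext u
    change centreTwist δ (Λ (fun j => B j) u.1) (flagTgt u) ∘ₗ x u = x u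
    rw [h1, centreTwist_id, LinearMap.id_comp]
  · intro u m i
    refine isPolyFun_centreTwist (f := fun b => Λ b u.1) δ (fun z i => ?_) (flagTgt u) (x u m) i
    let ℓ : Dual K (Fin s → Fin p → V) := LinearMap.proj i ∘ₗ e.symm.toLinearMap ∘ₗ
      LinearMap.applyₗ (e z) ∘ₗ ((B u.1).constr K).toLinearMap ∘ₗ LinearMap.proj u.1
    exact IsPolyFun.dual ℓ
  · intro b hb
    have hL : ∀ j, Function.Injective (L b j) := fun j =>
      (B j).injective_constr_of_linearIndependent (hb j)
    let θ : ∀ v : Option (Fin s × Fin r), (Fin (armDim p δ v) → K) →ₗ[K] V := fun v =>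
      match v with
      | none => e.toLinearMap
      | some u => L b u.1 ∘ₗ e.toLinearMap ∘ₗ toCentre x (some u)
    have hθ : ∀ j v, (v = none ∨ ∃ a, v = some (j, a)) → ∀ z,
        θ v (centreTwist δ (Λ b j) v z) = L b j (e (toCentre x v z)) := by
      rintro j _ (rfl | ⟨a, rfl⟩) z
      · rw [toCentre_none]
        change e (e.symm (L b j (e z))) = L b j (e z)
        exact e.apply_symm_apply _
      · rfl
    refine ⟨θ, ⟨?_, e.surjective, fun u m => ?_, fun u => ?_⟩⟩
    · rintro (_ | u)
      · exact e.injective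
      · exact (hL _).comp (e.injective.comp (toCentre_injective x hx _))
    · have h1 := hθ u.1 (flagTgt u) ((flagTgt_cases u).imp id fun ⟨a, _, h⟩ => ⟨a, h⟩) (x u m)
      change θ (flagTgt u) (centreTwist δ (Λ b u.1) (flagTgt u) (x u m)) = L b u.1 (e (toCentre x (some u) m))
      rw [h1, toCentre_some]
      rfl
    · have h1 : LinearMap.range (θ (some u)) = (E u.1 u.2).map (L b u.1) := by
        change LinearMap.range (L b u.1 ∘ₗ e.toLinearMap ∘ₗ toCentre x (some u)) = _
        rw [LinearMap.range_comp, LinearMap.range_comp]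
      rw [h1, ← hB, hEδ, spanFlag, spanFlag, Submodule.map_span, Set.image_image]
      congr 1
      exact Set.image_congr fun l _ => (B u.1).constr_basis K (b u.1) l

end FlagFamily

section Realisation

variable {K V Q : Type} [Field K] [AddCommGroup V] [Module K V] [AddCommGroup Q] [Module K Q]
  {s r p q : ℕ} {δ ε : Fin s → Fin r → ℕ}
  {x : RepMaps K some flagTgt fun v => Fin (armDim p δ v) → K}
  {y : RepMaps K some flagTgt fun v => Fin (armDim q ε v) → K}
  {F : Fin s → ℕ → Submodule K V} {G : Fin s → ℕ → Submodule K Q}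
  {θ : ∀ v, (Fin (armDim p δ v) → K) →ₗ[K] V} {ψ : ∀ v, (Fin (armDim q ε v) → K) →ₗ[K] Q}

namespace IsFlagRealisation

/-- The identification of the ambient space of the flags with the space at the centre. -/
def centreEquiv (hθ : IsFlagRealisation x F θ) : (Fin (armDim p δ none) → K) ≃ₗ[K] V :=
  LinearEquiv.ofBijective (θ none) ⟨hθ.injective none, hθ.surjective⟩

theorem centreEquiv_symm_apply (hθ : IsFlagRealisation x F θ) (m : Fin (armDim p δ none) → K) :
    hθ.centreEquiv.symm (θ none m) = m :=
  hθ.centreEquiv.symm_apply_apply m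

/-- The linear map on ambient spaces induced by a linear map of spaces at the centre. -/
def induced (hθ : IsFlagRealisation x F θ) (ψ : (Fin (armDim q ε none) → K) →ₗ[K] Q) :
    ((Fin (armDim p δ none) → K) →ₗ[K] (Fin (armDim q ε none) → K)) →ₗ[K] (V →ₗ[K] Q) :=
  LinearMap.lcomp K Q hθ.centreEquiv.symm.toLinearMap ∘ₗ LinearMap.llcomp K _ _ _ ψ

theorem induced_apply (hθ : IsFlagRealisation x F θ) (ψ : (Fin (armDim q ε none) → K) →ₗ[K] Q)
    (f : (Fin (armDim p δ none) → K) →ₗ[K] (Fin (armDim q ε none) → K)) (m) :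
    hθ.induced ψ f (θ none m) = ψ (f m) :=
  congrArg (fun z => ψ (f z)) (hθ.centreEquiv_symm_apply m)

theorem induced_apply_of_mem (hθ : IsFlagRealisation x F θ) (hψ : IsFlagRealisation y G ψ)
    {S : ∀ v, Submodule K (Fin (armDim p δ v) → K)}
    (hS : ∀ u, ∀ m ∈ S (some u), x u m ∈ S (flagTgt u))
    {η : ∀ v, (Fin (armDim p δ v) → K) →ₗ[K] (Fin (armDim q ε v) → K)}
    (hη : ∀ u, ∀ m ∈ S (some u), η (flagTgt u) (x u m) = y u (η (some u) m)) :
    ∀ v, ∀ m ∈ S v, hθ.induced (ψ none) (η none) (θ v m) = ψ v (η v m) := by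
  refine flagTgt_induction ?_ fun u hu => ?_
  · intro m _
    exact hθ.induced_apply _ _ m
  · intro m hm
    rw [← hθ.map_arrow, hu _ (hS u m hm), hη u m hm, hψ.map_arrow]

theorem finrank_comap (hθ : IsFlagRealisation x F θ) (W : Submodule K V) (v) :
    finrank K (comap (θ v) W) = finrank K ↥(W ⊓ LinearMap.range (θ v)) := by
  rw [inf_comm, ← Submodule.map_comap_eq]
  exact (Submodule.equivMapOfInjective _ (hθ.injective v) _).finrank_eq

theorem finrank_repHom (hθ : IsFlagRealisation x F θ) (hψ : IsFlagRealisation y G ψ)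
    {H : Submodule K (V →ₗ[K] Q)}
    (hH : ∀ f, f ∈ H ↔ ∀ j a, ∀ z ∈ F j (δ j a), f z ∈ G j (ε j a)) :
    finrank K (repHom x y) = finrank K H := by
  let R : repHom x y →ₗ[K] (V →ₗ[K] Q) :=
    hθ.induced (ψ none) ∘ₗ LinearMap.proj none ∘ₗ (repHom x y).subtype
  have hR : ∀ φ : repHom x y, ∀ v m, R φ (θ v m) = ψ v (φ.1 v m) := fun φ v m =>
    hθ.induced_apply_of_mem hψ (S := fun _ => ⊤) (fun _ _ _ => mem_top)
      (fun u m _ => mem_repHom.1 φ.2 u m) v m mem_top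
  have hinj : Function.Injective R := by
    intro φ φ' h
    refine Subtype.ext (funext fun v => LinearMap.ext fun m => hψ.injective v ?_)
    rw [← hR, ← hR, h]
  have hrange : LinearMap.range R = H := by
    ext f
    rw [hH]
    constructor
    · rintro ⟨φ, rfl⟩ j a z hz
      rw [← hθ.range_eq (j, a)] at hz
      obtain ⟨m, rfl⟩ := hz
      rw [hR, ← hψ.range_eq (j, a)]
      exact ⟨_, rfl⟩
    · intro hf
      choose g hg using fun v =>
        LinearMap.exists_leftInverse_of_injective (ψ v) (LinearMap.ker_eq_bot.2 (hψ.injective v))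
      have hg' : ∀ v m, ψ v (g v (f (θ v m))) = f (θ v m) := by
        intro v m
        have : f (θ v m) ∈ LinearMap.range (ψ v) := by
          cases v with
          | none => exact hψ.surjective _
          | some u =>
            rw [hψ.range_eq u]
            exact hf u.1 u.2 _ (by rw [← hθ.range_eq u]; exact ⟨m, rfl⟩)
        obtain ⟨w, hw⟩ := this
        rw [← hw]
        exact congrArg (ψ v) (LinearMap.congr_fun (hg v) w)
      refine ⟨⟨fun v => g v ∘ₗ f ∘ₗ θ v, mem_repHom.2 fun u m => hψ.injective _ ?_⟩, ?_⟩
      · simp only [LinearMap.comp_apply]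
        rw [hg', hψ.map_arrow, hg', hθ.map_arrow]
      · refine LinearMap.ext fun z => ?_
        obtain ⟨m, rfl⟩ := hθ.surjective z
        rw [hR]
        exact hg' none m
  rw [← hrange, LinearMap.finrank_range_of_inj hinj]

end IsFlagRealisation

/-- The subspaces arising from iterated kernels are the terms of a strictly decreasing filtration
by kernels of linear maps respecting the flags. -/
theorem IsIterKer.exists_filtration (hθ : IsFlagRealisation x F θ) (hψ : IsFlagRealisation y G ψ)
    {T : ∀ v, Submodule K (Fin (armDim p δ v) → K)} (hT : IsIterKer x y T) :
    ∃ (h : ℕ) (S : ℕ → Submodule K V) (η : ℕ → V →ₗ[K] Q), S 0 = ⊤ ∧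
      (∀ u < h, S (u + 1) = S u ⊓ LinearMap.ker (η u) ∧ S (u + 1) < S u ∧
        ∀ j a, ∀ z ∈ S u, z ∈ F j (δ j a) → η u z ∈ G j (ε j a)) ∧
      ∀ v, T v = comap (θ v) (S h) := by
  induction hT with
  | top => exact ⟨0, fun _ => ⊤, 0, rfl, fun u hu => absurd hu u.not_lt_zero, fun v => rfl⟩
  | @step T hT η hη ih =>
    obtain ⟨h, S, ξ, h0, hS, hTS⟩ := ih
    have key := hθ.induced_apply_of_mem hψ hT.isSubrep hη
    set ζ := hθ.induced (ψ none) (η none)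
    have hker : ∀ v, T v ⊓ LinearMap.ker (η v) = comap (θ v) (S h ⊓ LinearMap.ker ζ) := by
      intro v
      ext m
      rw [comap_inf, ← hTS v]
      refine and_congr_right fun hm => ?_
      change η v m = 0 ↔ ζ (θ v m) = 0
      rw [key v m hm, map_eq_zero_iff _ (hψ.injective v)]
    by_cases hle : S h ≤ LinearMap.ker ζ
    · refine ⟨h, S, ξ, h0, hS, fun v => ?_⟩
      exact (hker v).trans (by rw [inf_eq_left.2 hle])
    · refine ⟨h + 1, fun u => if u ≤ h then S u else S h ⊓ LinearMap.ker ζ,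
        fun u => if u < h then ξ u else ζ, ?_, fun u hu => ?_, fun v => ?_⟩
      · simpa using h0
      · obtain hu | rfl := Nat.lt_succ_iff_lt_or_eq.1 hu
        · have hu' : u + 1 ≤ h := hu
          simpa only [if_pos hu.le, if_pos hu', if_pos hu] using hS u hu
        · simp only [le_refl, if_true, lt_irrefl, if_false, if_neg (Nat.not_succ_le_self u)]
          refine ⟨trivial, lt_of_le_of_ne inf_le_left fun h => hle (inf_eq_left.1 h), ?_⟩
          intro j a z hz hzF
          rw [← hθ.range_eq (j, a)] at hzF
          obtain ⟨m, rfl⟩ := hzF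
          rw [key (some (j, a)) m (by rw [hTS]; exact hz), ← hψ.range_eq (j, a)]
          exact ⟨_, rfl⟩
      · simp only [if_neg (Nat.not_succ_le_self h)]
        exact hker v

end Realisation

section SchubertPosition

theorem exists_strictMono_card_filter_eq {r d : ℕ} {c : ℕ → ℕ} (h0 : c 0 = 0) (hc : Monotone c)
    (hd : c r = d) (hc1 : ∀ u, c (u + 1) ≤ c u + 1) :
    ∃ J : Fin d → Fin r, StrictMono J ∧
      ∀ u ≤ r, c u = (Finset.univ.filter fun t : Fin d => (J t : ℕ) + 1 ≤ u).card := by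
  have hr : ∀ t : Fin d, ∃ a, (t : ℕ) < c (a + 1) := fun t =>
    ⟨r, lt_of_lt_of_le (hd ▸ t.2) (hc r.le_succ)⟩
  let f : Fin d → ℕ := fun t => Nat.find (hr t)
  have hf : ∀ t u, f t + 1 ≤ u ↔ (t : ℕ) < c u := fun t u => by
    refine ⟨fun h => lt_of_lt_of_le (Nat.find_spec (hr t)) (hc h), fun h => ?_⟩
    cases u with
    | zero => rw [h0] at h; exact absurd h (Nat.not_lt_zero _)
    | succ u => exact Nat.succ_le_succ (Nat.find_min' (hr t) h)
  refine ⟨fun t => ⟨f t, (hf t r).2 (hd ▸ t.2)⟩, fun t t' htt' => ?_, fun u hu => ?_⟩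
  · refine (hf t (f t')).2 ?_
    have h1 : (t' : ℕ) < c (f t' + 1) := Nat.find_spec (hr t')
    have h2 := hc1 (f t')
    have h3 : (t : ℕ) < t' := htt'
    omega
  · simp only [hf]
    rw [Fin.card_filter_val_lt, min_eq_right (hd ▸ hc hu)]

variable {K V : Type} [Field K] [AddCommGroup V] [Module K V]

theorem isFlag_spanFlag {r : ℕ} (hr : finrank K V = r) {b : Fin r → V}
    (hb : LinearIndependent K b) : IsFlag (spanFlag K b) := by
  refine ⟨fun m m' h => span_mono (Set.image_mono fun a ha => lt_of_lt_of_le ha h), fun m => ?_⟩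
  have h1 := finrank_span_eq_card
    (hb.comp (Subtype.val : {a : Fin r | (a : ℕ) < m} → Fin r) Subtype.val_injective)
  rw [spanFlag, Set.image_eq_range, hr, min_comm]
  refine h1.trans ?_
  rw [← Fin.card_filter_val_lt, ← Fintype.card_subtype]
  rfl

variable [FiniteDimensional K V]

theorem finrank_inf_le_add (W : Submodule K V) {E E' : Submodule K V} (h : E ≤ E') :
    finrank K ↥(W ⊓ E') + finrank K E ≤ finrank K ↥(W ⊓ E) + finrank K E' := by
  have h1 := Submodule.finrank_sup_add_finrank_inf_eq (W ⊓ E') E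
  rw [inf_assoc, inf_eq_right.2 h] at h1
  have h2 : finrank K ↥(W ⊓ E' ⊔ E) ≤ finrank K E' :=
    Submodule.finrank_mono (sup_le inf_le_right h)
  omega

theorem exists_cellMem {E : ℕ → Submodule K V} (hE : IsFlag E) {r : ℕ} (hr : finrank K V = r)
    (W : Submodule K V) :
    ∃ J : Fin (finrank K W) → Fin r, StrictMono J ∧ cellMem J E W := by
  obtain ⟨hmono, hdim⟩ := hE
  rw [hr] at hdim
  have htop : E r = ⊤ := Submodule.eq_top_of_finrank_eq (by rw [hdim, min_self, hr])
  have hW : W ⊓ E r = W := by rw [htop, inf_top_eq]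
  have h0 : finrank K ↥(W ⊓ E 0) = 0 := by
    have h1 : finrank K ↥(W ⊓ E 0) ≤ finrank K (E 0) := Submodule.finrank_mono inf_le_right
    rw [hdim, Nat.zero_min] at h1
    exact Nat.le_zero.1 h1
  have hsucc : ∀ u, finrank K ↥(W ⊓ E (u + 1)) ≤ finrank K ↥(W ⊓ E u) + 1 := fun u => by
    have h1 := finrank_inf_le_add W (hmono (Nat.le_add_right u 1))
    rw [hdim, hdim] at h1
    omega
  obtain ⟨J, hJ, hJc⟩ := exists_strictMono_card_filter_eq (r := r) (c := fun u => finrank K ↥(W ⊓ E u))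
    h0 (fun u u' h => Submodule.finrank_mono (inf_le_inf_left W (hmono h)))
    (show finrank K ↥(W ⊓ E r) = finrank K W by rw [hW]) hsucc
  exact ⟨J, hJ, rfl, hJc⟩

end SchubertPosition

section Numerics

theorem sum_range_ite_sub (g : ℕ → ℤ) {b m : ℕ} (h : b ≤ m) :
    ∑ a ∈ Finset.range m, (if b ≤ a then g a - g (a + 1) else 0) = g b - g m := by
  induction m, h using Nat.le_induction with
  | base =>
    rw [sub_self]
    exact Finset.sum_eq_zero fun a ha => if_neg (Nat.not_le.2 (Finset.mem_range.1 ha))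
  | succ m hm ih =>
    rw [Finset.sum_range_succ, ih, if_pos hm]
    ring

variable {s r : ℕ}

theorem sum_arm_sub (β : Option (Fin s × Fin r) → ℤ) (j : Fin s) (b : Fin r) :
    ∑ a, (if b ≤ a then β (some (j, a)) - β (flagTgt (j, a)) else 0) =
      β (some (j, b)) - β none := by
  let g : ℕ → ℤ := fun a => β (if h : a < r then some (j, ⟨a, h⟩) else none)
  have h1 := sum_range_ite_sub g b.2.le
  rw [← Fin.sum_univ_eq_sum_range fun a => if (b : ℕ) ≤ a then g a - g (a + 1) else 0] at h1
  have hg : ∀ a : Fin r, g a = β (some (j, a)) := fun a => by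
    simp only [g, dif_pos a.2]
  have hr : g r = β none := by simp only [g, lt_irrefl, dif_neg, not_false_iff]
  rw [hg, hr] at h1
  rw [← h1]
  exact Finset.sum_congr rfl fun a _ => by rw [hg]; rfl

theorem eulerForm_flagTgt {d : ℕ} {α : Option (Fin s × Fin r) → ℤ} {J : Fin s → Fin d → Fin r}
    (h0 : α none = d)
    (hα : ∀ j a, α (some (j, a)) = (Finset.univ.filter fun t => J j t ≤ a).card)
    (β : Option (Fin s × Fin r) → ℤ) :
    eulerForm some flagTgt α β =
      d * β none + ∑ j, ∑ t, (β (some (j, J j t)) - β none) := by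
  have h1 : ∑ u : Fin s × Fin r, α (some u) * (β (some u) - β (flagTgt u)) =
      ∑ j, ∑ t, (β (some (j, J j t)) - β none) := by
    rw [Fintype.sum_prod_type]
    refine Finset.sum_congr rfl fun j _ => ?_
    simp only [← sum_arm_sub]
    rw [Finset.sum_comm]
    refine Finset.sum_congr rfl fun a _ => ?_
    rw [hα, Finset.sum_ite, Finset.sum_const_zero, add_zero, Finset.sum_const, nsmul_eq_mul]
  rw [← h1, eulerForm, Fintype.sum_option, h0]
  simp only [mul_sub, Finset.sum_sub_distrib]
  ring

end Numerics

section Generic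

variable {K : Type} [Field K]

theorem exists_injective_of_eval_ne_zero {ι κ : Type} [Fintype κ] {src tgt : κ → ι} {d : ι → ℕ}
    (hd : ∀ u, d (src u) ≤ d (tgt u)) :
    ∃ g : MvPolynomial (Σ u, Fin (d (tgt u)) × Fin (d (src u))) K, g ≠ 0 ∧
      ∀ t, MvPolynomial.eval t g ≠ 0 →
        ∀ u, Function.Injective (matRep (src := src) (tgt := tgt) (I := fun v => Fin (d v)) t u) := by
  let m : ∀ u, Matrix (Fin (d (src u))) (Fin (d (src u)))
      (MvPolynomial (Σ u, Fin (d (tgt u)) × Fin (d (src u))) K) := fun u =>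
    Matrix.of fun i j => MvPolynomial.X ⟨u, Fin.castLE (hd u) i, j⟩
  have hm : ∀ t u, MvPolynomial.eval t (m u).det =
      (Matrix.of fun i j => t ⟨u, Fin.castLE (hd u) i, j⟩).det := fun t u => by
    rw [RingHom.map_det]
    congr 1
    ext i j
    simp [m]
  refine ⟨∏ u, (m u).det, ?_, fun t ht u => ?_⟩
  · refine Finset.prod_ne_zero_iff.2 fun u _ h => ?_
    have h1 := hm (fun q => if (q.2.1 : ℕ) = q.2.2 then 1 else 0) u
    have h2 : (Matrix.of fun i j : Fin (d (src u)) =>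
        if (Fin.castLE (hd u) i : ℕ) = j then (1 : K) else 0) = 1 := by
      ext i j
      simp [Matrix.one_apply, Fin.ext_iff]
    rw [h, map_zero, h2, Matrix.det_one] at h1
    exact zero_ne_one h1
  · rw [map_prod] at ht
    have h1 := Finset.prod_ne_zero_iff.1 ht u (Finset.mem_univ u)
    rw [hm] at h1
    rw [← LinearMap.ker_eq_bot, LinearMap.ker_eq_bot']
    intro z hz
    refine Matrix.eq_zero_of_mulVec_eq_zero h1 (funext fun i => ?_)
    exact congrFun hz (Fin.castLE (hd u) i)

theorem matRep_repEntries {ι κ : Type} {src tgt : κ → ι} {d : ι → ℕ}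
    (x : RepMaps K src tgt fun v => Fin (d v) → K) :
    matRep (repEntries (fun v => Pi.basisFun K (Fin (d v))) x) = x := by
  funext u
  refine Eq.trans ?_ (Matrix.toLin'_toMatrix' (x u))
  change Matrix.toLin' _ = _
  congr 1
  ext i j
  simp [repEntries, LinearMap.toMatrix'_apply]

variable {V Q : Type} [AddCommGroup V] [Module K V] [FiniteDimensional K V]
  [AddCommGroup Q] [Module K Q] [FiniteDimensional K Q]

/-- Generic flags are realised by pairs of representations whose extension group is computed by an
iterated kernel. -/
theorem genericFlagPairs_hasIterKer [Infinite K] {s r p q : ℕ} (hp : finrank K V = p)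
    (hq : finrank K Q = q) {δ ε : Fin s → Fin r → ℕ}
    (hδ : ∀ u, armDim p δ (some u) ≤ armDim p δ (flagTgt u))
    (hε : ∀ u, armDim q ε (some u) ≤ armDim q ε (flagTgt u)) :
    GenericFlagPairs K (M := V) (Q := Q) s p q fun F G =>
      ∃ (x : RepMaps K some flagTgt fun v => Fin (armDim p δ v) → K)
        (y : RepMaps K some flagTgt fun v => Fin (armDim q ε v) → K) (θ : _) (ψ : _),
        IsFlagRealisation (V := V) x F θ ∧ IsFlagRealisation (V := Q) y G ψ ∧
          HasIterKer x y := by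
  obtain ⟨f, hf, hfH⟩ := exists_hasIterKer_of_eval_ne_zero (k := K) some flagTgt
    (I := fun v => Fin (armDim p δ v)) (J := fun v => Fin (armDim q ε v))
  obtain ⟨g, hg, hgI⟩ := exists_injective_of_eval_ne_zero (K := K) hδ
  obtain ⟨g', hg', hgI'⟩ := exists_injective_of_eval_ne_zero (K := K) hε
  have hne : f * (MvPolynomial.rename Sum.inl g * MvPolynomial.rename Sum.inr g') ≠ 0 :=
    mul_ne_zero hf (mul_ne_zero
      ((map_ne_zero_iff _ (MvPolynomial.rename_injective _ Sum.inl_injective)).2 hg)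
      ((map_ne_zero_iff _ (MvPolynomial.rename_injective _ Sum.inr_injective)).2 hg'))
  obtain ⟨t, ht⟩ : ∃ t, MvPolynomial.eval t
      (f * (MvPolynomial.rename Sum.inl g * MvPolynomial.rename Sum.inr g')) ≠ 0 := by
    by_contra! h
    exact hne (MvPolynomial.funext fun t => by rw [h, map_zero])
  rw [map_mul, map_mul, MvPolynomial.eval_rename, MvPolynomial.eval_rename, mul_ne_zero_iff,
    mul_ne_zero_iff] at ht
  obtain ⟨htf, htg, htg'⟩ := ht
  obtain ⟨X, b, hb, hXb, hXpoly, hX⟩ := exists_flagFamily hp (hgI _ htg)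
  obtain ⟨Y, c, hc, hYc, hYpoly, hY⟩ := exists_flagFamily hq (hgI' _ htg')
  let E : (Fin s → Fin p → V) → _ → K := fun b =>
    repEntries (fun v => Pi.basisFun K (Fin (armDim p δ v))) (X b)
  let E' : (Fin s → Fin q → Q) → _ → K := fun c =>
    repEntries (fun v => Pi.basisFun K (Fin (armDim q ε v))) (Y c)
  let Φ : (Fin s → Fin p → V) × (Fin s → Fin q → Q) → K := fun z =>
    MvPolynomial.eval (Sum.elim (E z.1) (E' z.2)) f
  have hΦ : IsPolyFun K Φ := by
    refine IsPolyFun.eval (φ := fun z : (Fin s → Fin p → V) × (Fin s → Fin q → Q) =>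
      Sum.elim (E z.1) (E' z.2)) ?_ f
    let π : (Fin s → Fin p → V) × (Fin s → Fin q → Q) →ₗ[K] (Fin s → Fin p → V) :=
      LinearMap.fst K _ _
    let π' : (Fin s → Fin p → V) × (Fin s → Fin q → Q) →ₗ[K] (Fin s → Fin q → Q) :=
      LinearMap.snd K _ _
    rintro (i | i)
    · exact (hXpoly i.1 _ i.2.1).comp π
    · exact (hYpoly i.1 _ i.2.1).comp π'
  refine ⟨{z | Φ z ≠ 0}, hΦ.isOpen_ne_zero, ⟨(b, c), ?_, hb, hc⟩, fun z hz hLI => ?_⟩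
  · have h1 : Sum.elim (E b) (E' c) = t := by
      simp only [E, E', hXb, hYc, repEntries_matRep, Sum.elim_comp_inl_inr]
    change MvPolynomial.eval (Sum.elim (E b) (E' c)) f ≠ 0
    rwa [h1]
  · obtain ⟨θ, hθ⟩ := hX z.1 hLI.1
    obtain ⟨ψ, hψ⟩ := hY z.2 hLI.2
    have h1 := hfH _ hz
    rw [Sum.elim_comp_inl, Sum.elim_comp_inr, matRep_repEntries, matRep_repEntries] at h1
    exact ⟨_, _, θ, ψ, hθ, hψ, h1⟩

end Generic

theorem mem_homConstraint {K V Q : Type} [Field K] [AddCommGroup V] [Module K V]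
    [AddCommGroup Q] [Module K Q] {P : Submodule K V} {R : Submodule K Q} {f : V →ₗ[K] Q} :
    f ∈ homConstraint P R ↔ ∀ z ∈ P, f z ∈ R := by
  rw [homConstraint, LinearMap.mem_ker, LinearMap.ext_iff]
  exact ⟨fun h z hz => (Submodule.Quotient.mk_eq_zero R).1 (h ⟨z, hz⟩),
    fun h z => (Submodule.Quotient.mk_eq_zero R).2 (h z z.2)⟩

theorem mem_homSpace {K V Q : Type} [Field K] [AddCommGroup V] [Module K V]
    [AddCommGroup Q] [Module K Q] {n r s : ℕ} {I : Fin s → Fin r → Fin n}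
    {F : Fin s → ℕ → Submodule K V} {G : Fin s → ℕ → Submodule K Q} {f : V →ₗ[K] Q} :
    f ∈ homSpace I F G ↔ ∀ (j : Fin s) (a : Fin r), ∀ z ∈ F j ((a : ℕ) + 1),
      f z ∈ G j ((I j a : ℕ) - (a : ℕ)) := by
  simp only [homSpace, mem_iInf, mem_homConstraint]

section

theorem strictMono_add_le {n r : ℕ} {f : Fin r → Fin n} (hf : StrictMono f) (m : ℕ) :
    ∀ a b : Fin r, (b : ℕ) = a + m → (f a : ℕ) + m ≤ f b := by
  induction m with
  | zero =>
    intro a b h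
    obtain rfl : b = a := Fin.ext h
    exact le_rfl
  | succ m ih =>
    intro a b h
    have h1 := ih a ⟨a + m, by omega⟩ rfl
    have h2 : f ⟨a + m, by omega⟩ < f b := hf (Fin.lt_def.2 (by simp only; omega))
    have h3 := Fin.lt_def.1 h2
    omega

theorem strictMono_le_apply {n r : ℕ} {f : Fin r → Fin n} (hf : StrictMono f) (a : Fin r) :
    (a : ℕ) ≤ f a := by
  have h1 := strictMono_add_le hf a ⟨0, a.pos⟩ a (by simp)
  omega

theorem strictMono_apply_add_le {n r : ℕ} {f : Fin r → Fin n} (hf : StrictMono f) (a : Fin r) :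
    (f a : ℕ) + r ≤ n + a := by
  have h1 := strictMono_add_le hf (r - 1 - a) a ⟨r - 1, Nat.sub_lt a.pos one_pos⟩
    (show r - 1 = (a : ℕ) + (r - 1 - a) by omega)
  have h2 := (f ⟨r - 1, Nat.sub_lt a.pos one_pos⟩).2
  omega

theorem armDim_le_of_le {s r p : ℕ} {δ : Fin s → Fin r → ℕ} (hp : ∀ j a, δ j a ≤ p)
    (hδ : ∀ j (a b : Fin r), (b : ℕ) = a + 1 → δ j a ≤ δ j b) (u : Fin s × Fin r) :
    armDim p δ (some u) ≤ armDim p δ (flagTgt u) := by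
  obtain h | ⟨a, ha, h⟩ := flagTgt_cases u <;> rw [h]
  · exact hp _ _
  · exact hδ _ _ _ ha

theorem dimVec_armDim (K : Type) [Field K] {s r : ℕ} (p : ℕ) (δ : Fin s → Fin r → ℕ)
    (v : Option (Fin s × Fin r)) :
    dimVec K (fun v => Fin (armDim p δ v) → K) v = armDim p δ v := by
  rw [dimVec, finrank_fintype_fun_eq_card, Fintype.card_fin]

theorem card_filter_strictMono_le {r d : ℕ} {J : Fin d → Fin r} (hJ : StrictMono J) (t : Fin d) :
    (Finset.univ.filter fun t' => J t' ≤ J t).card = (t : ℕ) + 1 := by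
  simp only [hJ.le_iff_le]
  rw [Finset.filter_ge_eq_Iic, Fin.card_Iic]

variable {n r s d : ℕ} {I : Fin s → Fin r → Fin n} {J : Fin s → Fin d → Fin r}
  {α : Option (Fin s × Fin r) → ℤ}

theorem eulerForm_sub_eq_eDimZ (hJ : ∀ j, StrictMono (J j)) (h0 : α none = d)
    (hα : ∀ j a, α (some (j, a)) = (Finset.univ.filter fun t => J j t ≤ a).card)
    {β : Option (Fin s × Fin r) → ℤ} (hβ0 : β none = r) (hβ : ∀ j a, β (some (j, a)) = a + 1) :
    eulerForm some flagTgt α (β - α) = eDimZ r d J := by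
  rw [eulerForm_flagTgt h0 hα, eDimZ, sub_eq_add_neg (_ * _), ← Finset.sum_neg_distrib]
  simp only [← Finset.sum_neg_distrib, Pi.sub_apply, h0, hβ0, hβ, hα,
    card_filter_strictMono_le (hJ _)]
  congr 1
  refine Finset.sum_congr rfl fun j _ => Finset.sum_congr rfl fun t _ => ?_
  push_cast
  ring

theorem neg_eulerForm_eq_daggerZ (h0 : α none = d)
    (hα : ∀ j a, α (some (j, a)) = (Finset.univ.filter fun t => J j t ≤ a).card)
    {β : Option (Fin s × Fin r) → ℤ} (hβ0 : β none = n - r)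
    (hβ : ∀ j a, β (some (j, a)) = I j a - a) :
    -eulerForm some flagTgt α β = daggerZ n r d I J := by
  rw [eulerForm_flagTgt h0 hα, daggerZ, neg_add, add_comm, sub_eq_add_neg,
    ← Finset.sum_neg_distrib]
  simp only [← Finset.sum_neg_distrib, hβ0, hβ]
  congr 1
  refine Finset.sum_congr rfl fun j _ => Finset.sum_congr rfl fun t _ => ?_
  ring

theorem eulerForm_eq_sub_codimZ {α β : Option (Fin s × Fin r) → ℤ} (hα0 : α none = r)
    (hα : ∀ j a, α (some (j, a)) = a + 1) (hβ0 : β none = n - r)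
    (hβ : ∀ j a, β (some (j, a)) = I j a - a) :
    eulerForm some flagTgt α β = r * ((n : ℤ) - r) - ∑ j, codimZ n r (I j) := by
  rw [eulerForm_flagTgt (d := r) (J := fun _ => id) hα0 fun j a => ?_, hβ0,
    sub_eq_add_neg (_ * _),
    ← Finset.sum_neg_distrib]
  · congr 1
    refine Finset.sum_congr rfl fun j _ => ?_
    rw [codimZ, ← Finset.sum_neg_distrib]
    refine Finset.sum_congr rfl fun t _ => ?_
    rw [hβ, id]
    ring
  · rw [hα]
    exact_mod_cast (card_filter_strictMono_le strictMono_id a).symm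

end

/-- Theorem `stonger`.  For nonzero `V, Q` of dimensions `r, n-r`
and a generic `(𝓕,𝓖) ∈ Fl(V)^s × Fl(Q)^s`, there are a filtration
`S^{(h)} ⊊ ⋯ ⊊ S^{(1)} ⊊ S^{(0)} = V` and injections `η_u : S^{(u)}/S^{(u+1)} ↪ Q`
(recorded as maps `η_u : S^{(u)} → Q` with kernel exactly `S^{(u+1)}`) such that:
(i) `dim(S^{(h)}, V, 𝓕) = 0`;
(ii) `η_u(S^{(u)} ∩ F^j_a) ⊆ G^j_{i^j_a - a}` for all `u, j, a`;
(iii) `dim Hom_𝓘(V,Q,𝓕,𝓖) = [dim Gr(r,n) - ∑_j codim ω_{I^j}] + (†^𝓘_{𝓙(h)})`,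
where `𝓙(h)` is the unique `s`-tuple of subsets of `[r]` with
`S^{(h)} ∈ ∩_j Ω°_{J^j(h)}(F^j_•)`. -/
theorem stmt16 (k : Type) [Field k] [IsAlgClosed k]
    {V Q : Type} [AddCommGroup V] [Module k V] [FiniteDimensional k V]
    [AddCommGroup Q] [Module k Q] [FiniteDimensional k Q]
    (n r s : ℕ) (hs : 0 < s) (hrn : r ≤ n) (hr : 0 < r) (hq : r < n)
    (hV : Module.finrank k V = r) (hQ : Module.finrank k Q = n - r)
    (I : Fin s → Fin r → Fin n) (hI : ∀ j, StrictMono (I j)) :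
    GenericFlagPairs k (M := V) (Q := Q) s r (n - r) (fun F G =>
      ∃ (h : ℕ) (S : Fin (h + 1) → Submodule k V),
        S 0 = ⊤ ∧
        (∀ u : Fin h, S u.succ < S u.castSucc) ∧
        ∃ η : (u : Fin h) → (↥(S u.castSucc) →ₗ[k] Q),
          (∀ u : Fin h,
            LinearMap.ker (η u) = Submodule.comap (S u.castSucc).subtype (S u.succ)) ∧
          (∀ (u : Fin h) (j : Fin s) (a : Fin r),
            Submodule.map (η u)
                (Submodule.comap (S u.castSucc).subtype (F j ((a : ℕ) + 1)))
              ≤ G j ((I j a : ℕ) - (a : ℕ))) ∧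
          ∃ (d : ℕ) (J : Fin s → Fin d → Fin r),
            Module.finrank k ↥(S (Fin.last h)) = d ∧
            (∀ j, StrictMono (J j)) ∧
            (∀ j, cellMem (J j) (F j) (S (Fin.last h))) ∧
            eDimZ r d J = 0 ∧
            (Module.finrank k ↥(homSpace I F G) : ℤ)
              = ((r : ℤ) * ((n : ℤ) - (r : ℤ)) - ∑ j : Fin s, codimZ n r (I j))
                + daggerZ n r d I J) := by
  have hδ := armDim_le_of_le (s := s) (p := r) (δ := fun _ (a : Fin r) => (a : ℕ) + 1)
    (fun _ a => a.2) fun _ a b hab => by omega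
  have hε := armDim_le_of_le (p := n - r) (δ := fun j (a : Fin r) => (I j a : ℕ) - a)
    (fun j a => by have := strictMono_apply_add_le (hI j) a; omega)
    fun j a b hab => by have := strictMono_add_le (hI j) 1 a b hab; omega
  have : Infinite k := inferInstance
  obtain ⟨U, hU, hne, hUF⟩ := genericFlagPairs_hasIterKer (K := k) hV hQ hδ hε
  refine ⟨U, hU, hne, fun z hz hLI => ?_⟩
  obtain ⟨x, y, θ, ψ, hθ, hψ, T, hT, hT0, hext⟩ := hUF z hz hLI
  obtain ⟨h, S, η, hS0, hS, hTS⟩ := hT.exists_filtration hθ hψ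
  choose J hJ hcell using fun j => exists_cellMem (isFlag_spanFlag hV (hLI.1 j)) hV (S h)
  have hα0 : dimVec k (fun v => ↥(T v)) none = finrank k (S h) := by
    rw [dimVec, hTS, hθ.finrank_comap, LinearMap.range_eq_top.2 hθ.surjective, inf_top_eq]
  have hα : ∀ j a, dimVec k (fun v => ↥(T v)) (some (j, a)) =
      (Finset.univ.filter fun t => J j t ≤ a).card := fun j a => by
    rw [dimVec, hTS, hθ.finrank_comap, hθ.range_eq, (hcell j).2 (a + 1) a.2]
    simp only [Nat.add_le_add_iff_right, Fin.le_def]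
  have hM : ∀ j a, dimVec k (fun v => Fin (armDim r (fun (_ : Fin s) (a : Fin r) =>
      (a : ℕ) + 1) v) → k) (some (j, a)) = (a : ℕ) + 1 := fun j a => by
    rw [dimVec_armDim]
    exact Nat.cast_succ _
  have hN0 : dimVec k (fun v => Fin (armDim (n - r) (fun j (a : Fin r) =>
      (I j a : ℕ) - a) v) → k) none = n - r := by
    rw [dimVec_armDim, ← Nat.cast_sub hrn]
    rfl
  have hN : ∀ j a, dimVec k (fun v => Fin (armDim (n - r) (fun j (a : Fin r) =>
      (I j a : ℕ) - a) v) → k) (some (j, a)) = (I j a : ℕ) - (a : ℕ) := fun j a => by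
    rw [dimVec_armDim, ← Nat.cast_sub (strictMono_le_apply (hI j) a)]
    rfl
  refine ⟨h, fun u => S u, hS0, fun u => (hS u u.2).2.1, fun u => (η u).domRestrict _,
    fun u => ?_, fun u j a => ?_, finrank k (S h), J, rfl, hJ, hcell, ?_, ?_⟩
  · change _ = comap _ (S (u + 1))
    rw [(hS u u.2).1]
    ext m
    exact ⟨fun hm => ⟨m.2, hm⟩, fun hm => hm.2⟩
  · rintro _ ⟨m, hm, rfl⟩
    exact (hS u u.2).2.2 j a m m.2 hm
  · rw [← eulerForm_sub_eq_eDimZ hJ hα0 hα (dimVec_armDim k r _ none) hM]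
    exact hT0
  · rw [← neg_eulerForm_eq_daggerZ hα0 hα hN0 hN, ← hext,
      ← eulerForm_eq_sub_codimZ (dimVec_armDim k r _ none) hM hN0 hN, extDim,
      hθ.finrank_repHom hψ fun f => mem_homSpace]
    ring

end
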